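/- Existence of Hamada coordinates near a regular flux surface: Let (B,J,p) be an integrable magnetic field on an open set U ⊆ ℝ³, let c ∈ ℝ, and let Λ be a compact connected component of p⁻¹(c) with ∇p(z) ≠ 0 for every z ∈ Λ. Then there exist real numbers ψ₁ < ψ₂, a C^∞ map Φ : (ψ₁,ψ₂) × ℝ² → U that is 2π-periodic in each of its last two arguments, has everywhere invertible differential, has image an open neighborhood of Λ, and satisfies Φ(ψ,θ,ζ) = Φ(ψ',θ',ζ') iff ψ = ψ', θ − θ' ∈ 2πℤ and ζ − ζ' ∈ 2πℤ; and C^∞ functions P, F, G, K, L : (ψ₁,ψ₂) → ℝ such that for all (ψ,θ,ζ): p(Φ(ψ,θ,ζ)) = P(ψ), det(DΦ) · (DΦ)⁻¹ (B∘Φ) = (0, G′(ψ), F′(ψ)), and det(DΦ) · (DΦ)⁻¹ (J∘Φ) = (0, L′(ψ), K′(ψ)) at (ψ,θ,ζ). -/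

import Mathlib

noncomputable section

open RealInnerProductSpace

/-- `ℝ³` as a Euclidean space. -/
abbrev R3 : Type := EuclideanSpace ℝ (Fin 3)

/-- The point `(x, y, z)` of `ℝ³`. -/
def pt (x y z : ℝ) : R3 := !₂[x, y, z]

/-- Divergence of a vector field: the trace of its derivative. -/
def divg (v : R3 → R3) (z : R3) : ℝ :=
  LinearMap.trace ℝ R3 (fderiv ℝ v z).toLinearMap

/-- Cross product on `ℝ³`. -/
def cross3 (u v : R3) : R3 :=
  pt (u 1 * v 2 - u 2 * v 1) (u 2 * v 0 - u 0 * v 2) (u 0 * v 1 - u 1 * v 0)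

/-- Standard basis vectors of `ℝ³`. -/
def e3 (i : Fin 3) : R3 := EuclideanSpace.single i 1

/-- Curl of a vector field on `ℝ³`. -/
def curl (v : R3 → R3) (z : R3) : R3 :=
  pt (fderiv ℝ v z (e3 1) 2 - fderiv ℝ v z (e3 2) 1)
     (fderiv ℝ v z (e3 2) 0 - fderiv ℝ v z (e3 0) 2)
     (fderiv ℝ v z (e3 0) 1 - fderiv ℝ v z (e3 1) 0)

/-- The Hessian of `p` at `z`, as a bilinear form. -/
def hess (p : R3 → ℝ) (z : R3) (u v : R3) : ℝ :=
  (iteratedFDeriv ℝ 2 p z) ![u, v]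

/-- `γ` is the image of a periodic integral curve of `B` lying in `U`. -/
def IsPeriodicOrbit (U : Set R3) (B : R3 → R3) (γ : Set R3) : Prop :=
  ∃ (c : ℝ → R3) (T : ℝ), 0 < T ∧ (∀ t, c t ∈ U) ∧
    (∀ t, c (t + T) = c t) ∧ (∀ t, HasDerivAt c (B (c t)) t) ∧ Set.range c = γ

/-- An integrable magnetic field `(B, J, p)` on an open set `U ⊆ ℝ³`. -/
structure IntegrableMagneticField (U : Set R3) (B J : R3 → R3) (p : R3 → ℝ) : Prop where
  isOpen_U : IsOpen U
  smooth_B : ContDiffOn ℝ (⊤ : ℕ∞) B U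
  smooth_J : ContDiffOn ℝ (⊤ : ℕ∞) J U
  smooth_p : ContDiffOn ℝ (⊤ : ℕ∞) p U
  B_ne_zero : ∀ z ∈ U, B z ≠ 0
  div_B : ∀ z ∈ U, divg B z = 0
  div_J : ∀ z ∈ U, divg J z = 0
  hamiltonian : ∀ z ∈ U, cross3 (J z) (B z) = gradient p z

/-- A nondegenerate elliptic magnetic axis: a compact image of a periodic integral
curve of `B` on which `∇p = 0` and the Hessian of `p`, restricted to the plane
orthogonal to `B`, is positive or negative definite. -/
def IsNondegenerateEllipticAxis (U : Set R3) (B : R3 → R3) (p : R3 → ℝ)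
    (γ : Set R3) : Prop :=
  IsCompact γ ∧ γ ⊆ U ∧ IsPeriodicOrbit U B γ ∧
  (∀ z ∈ γ, gradient p z = 0) ∧
  ∀ z ∈ γ,
    (∀ u : R3, u ≠ 0 → ⟪u, B z⟫ = 0 → 0 < hess p z u u) ∨
    (∀ u : R3, u ≠ 0 → ⟪u, B z⟫ = 0 → hess p z u u < 0)

/-- The solid cylinder `D_r × ℝ = {(x,y,φ) : x² + y² < r²}` in `ℝ³`. -/
def Dset (r : ℝ) : Set R3 := {q | (q 0) ^ 2 + (q 1) ^ 2 < r ^ 2}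

/-- The slab `(ψ₁, ψ₂) × ℝ²` in `ℝ³`. -/
def Slab (ψ₁ ψ₂ : ℝ) : Set R3 := {q | q 0 ∈ Set.Ioo ψ₁ ψ₂}

namespace Hamada

open Set Filter Topology

section Nemytskii

variable {T : Type} [TopologicalSpace T] [CompactSpace T]
  {E : Type} [NormedAddCommGroup E] [NormedSpace ℝ E]
  {G : Type} [NormedAddCommGroup G] [NormedSpace ℝ G]

/-- Pointwise application of a continuous family of operators to a continuous map. -/
def pointwiseApply : C(T, E →L[ℝ] G) →L[ℝ] C(T, E) →L[ℝ] C(T, G) :=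
  LinearMap.mkContinuous₂
    (LinearMap.mk₂ ℝ (fun (A : C(T, E →L[ℝ] G)) (γ : C(T, E)) =>
        (⟨fun t => A t (γ t), by fun_prop⟩ : C(T, G)))
      (fun A A' γ => by ext t; simp) (fun r A γ => by ext t; simp)
      (fun A γ γ' => by ext t; simp) (fun r A γ => by ext t; simp))
    1 (fun A γ => by
      rw [one_mul, ContinuousMap.norm_le _ (by positivity)]
      intro t
      exact (A t).le_of_opNorm_le_of_le (A.norm_coe_le_norm t) (γ.norm_coe_le_norm t))

@[simp] lemma pointwiseApply_apply (A : C(T, E →L[ℝ] G)) (γ : C(T, E)) (t : T) :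
    pointwiseApply A γ t = A t (γ t) := rfl

/-- The superposition operator `γ ↦ X ∘ γ`. -/
def superpose (X : C(E, G)) (γ : C(T, E)) : C(T, G) := X.comp γ

@[simp] lemma superpose_apply (X : C(E, G)) (γ : C(T, E)) (t : T) :
    superpose X γ t = X (γ t) := rfl

lemma hasFDerivAt_superpose (X : C(E, G)) (DX : C(E, E →L[ℝ] G))
    (hX : ∀ x, HasFDerivAt X (DX x) x) (γ : C(T, E)) :
    HasFDerivAt (superpose X) (pointwiseApply (superpose DX γ)) γ := by
  rw [hasFDerivAt_iff_isLittleO, Asymptotics.isLittleO_iff]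
  intro c hc
  have hK : IsCompact (range γ) := isCompact_range γ.continuous
  have hu := hK.uniformContinuousAt_of_continuousAt DX
    (fun a _ => DX.continuous.continuousAt) (Metric.dist_mem_uniformity hc)
  obtain ⟨δ, hδ, hu⟩ := Metric.mem_uniformity_dist.1 hu
  filter_upwards [Metric.ball_mem_nhds γ hδ] with γ' hγ'
  rw [ContinuousMap.norm_le _ (by positivity)]
  intro t
  have hd : dist (γ' t) (γ t) < δ := (ContinuousMap.dist_apply_le_dist t).trans_lt hγ'
  have := (convex_ball (γ t) δ).norm_image_sub_le_of_norm_fderiv_le' (𝕜 := ℝ) (f := X)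
    (φ := DX (γ t)) (C := c) (x := γ t) (y := γ' t)
    (fun x _ => (hX x).differentiableAt) (fun x hx => by
      rw [(hX x).fderiv, ← dist_eq_norm, dist_comm]
      exact (hu (a := γ t) (b := x) (by rwa [dist_comm]) ⟨t, rfl⟩).le)
    (Metric.mem_ball_self hδ) hd
  refine this.trans ?_
  gcongr
  exact (γ' - γ).norm_coe_le_norm t

lemma contDiff_superpose_nat (n : ℕ) : ∀ {G : Type} [NormedAddCommGroup G] [NormedSpace ℝ G]
    (X : C(E, G)), ContDiff ℝ n X →
    ContDiff ℝ n (superpose X : C(T, E) → C(T, G)) := by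
  induction n with
  | zero =>
    intro G _ _ X _
    rw [Nat.cast_zero, contDiff_zero]
    exact ContinuousMap.continuous_postcomp X
  | succ n ih =>
    intro G _ _ X hX
    rw [Nat.cast_succ] at hX ⊢
    have hX' := contDiff_succ_iff_fderiv.1 hX
    let DX : C(E, E →L[ℝ] G) := ⟨fderiv ℝ X, hX'.2.2.continuous⟩
    have hd := hasFDerivAt_superpose (T := T) X DX (fun x => (hX'.1 x).hasFDerivAt)
    refine contDiff_succ_iff_fderiv.2 ⟨fun γ => (hd γ).differentiableAt, by simp, ?_⟩
    have : fderiv ℝ (superpose X : C(T, E) → C(T, G))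
        = fun γ => pointwiseApply (superpose DX γ) := funext fun γ => (hd γ).fderiv
    rw [this]
    exact pointwiseApply.contDiff.comp (ih DX hX'.2.2)

lemma contDiff_superpose (X : C(E, G)) (hX : ContDiff ℝ (⊤ : ℕ∞) X) :
    ContDiff ℝ (⊤ : ℕ∞) (superpose X : C(T, E) → C(T, G)) :=
  contDiff_infty.2 fun n => contDiff_superpose_nat n X (contDiff_infty.1 hX n)

end Nemytskii

section Primitive

variable {E : Type} [NormedAddCommGroup E] [NormedSpace ℝ E] [CompleteSpace E]

/-- Extension of a map on the unit interval, constant outside. -/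
def ext01 (γ : C(unitInterval, E)) (t : ℝ) : E := γ (projIcc 0 1 zero_le_one t)

lemma continuous_ext01 (γ : C(unitInterval, E)) : Continuous (ext01 γ) :=
  γ.continuous.comp continuous_projIcc

lemma ext01_coe (γ : C(unitInterval, E)) (t : unitInterval) : ext01 γ t = γ t := by
  simp [ext01]

lemma hasDerivAt_primitive (γ : C(unitInterval, E)) (t : ℝ) :
    HasDerivAt (fun t => ∫ s in (0 : ℝ)..t, ext01 γ s) (ext01 γ t) t :=
  (continuous_ext01 γ).integral_hasStrictDerivAt 0 t |>.hasDerivAt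

/-- The primitive vanishing at `0`, as an operator on continuous maps on the unit interval. -/
def primitive : C(unitInterval, E) →L[ℝ] C(unitInterval, E) :=
  LinearMap.mkContinuous
    { toFun := fun γ => ⟨fun t => ∫ s in (0 : ℝ)..t, ext01 γ s,
        (continuous_iff_continuousAt.2 fun t =>
          (hasDerivAt_primitive γ t).continuousAt).comp continuous_subtype_val⟩
      map_add' := fun γ γ' => by
        ext t
        exact intervalIntegral.integral_add ((continuous_ext01 γ).intervalIntegrable _ _)
          ((continuous_ext01 γ').intervalIntegrable _ _)
      map_smul' := fun r γ => by
        ext t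
        exact intervalIntegral.integral_smul r _ } 1 (fun γ => by
      rw [one_mul, ContinuousMap.norm_le _ (by positivity)]
      intro t
      refine (intervalIntegral.norm_integral_le_of_norm_le_const (C := ‖γ‖)
        (fun s _ => γ.norm_coe_le_norm _)).trans ?_
      rw [sub_zero, abs_of_nonneg t.2.1]
      exact mul_le_of_le_one_right (norm_nonneg _) t.2.2)

lemma primitive_apply (γ : C(unitInterval, E)) (t : unitInterval) :
    primitive γ t = ∫ s in (0 : ℝ)..t, ext01 γ s := rfl

end Primitive

section LocalFlow

variable {E : Type} [NormedAddCommGroup E] [NormedSpace ℝ E] [CompleteSpace E]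

/-- The field `a₁ B + a₂ J`. -/
def comb (B J : C(E, E)) (a : ℝ × ℝ) (w : E) : E := a.1 • B w + a.2 • J w

/-- The embedding of `E` as constant maps on the unit interval. -/
def constCLM : E →L[ℝ] C(unitInterval, E) :=
  LinearMap.mkContinuous
    { toFun := fun x => ContinuousMap.const _ x
      map_add' := fun _ _ => rfl
      map_smul' := fun _ _ => rfl } 1 (fun x => by
        rw [one_mul, ContinuousMap.norm_le _ (by positivity)]
        exact fun _ => le_rfl)

@[simp] lemma constCLM_apply (x : E) (t : unitInterval) : constCLM x t = x := rfl

/-- The map whose zeros in the last component are the integral curves of `a₁ B + a₂ J`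
starting at `x`. -/
def flowMap (B J : C(E, E)) (q : ((ℝ × ℝ) × E) × C(unitInterval, E)) :
    ((ℝ × ℝ) × E) × C(unitInterval, E) :=
  (q.1, q.2 - constCLM q.1.2
    - primitive (q.1.1.1 • superpose B q.2 + q.1.1.2 • superpose J q.2))

lemma contDiff_flowMap {B J : C(E, E)} (hB : ContDiff ℝ (⊤ : ℕ∞) B)
    (hJ : ContDiff ℝ (⊤ : ℕ∞) J) : ContDiff ℝ (⊤ : ℕ∞) (flowMap B J) := by
  have h1 : ContDiff ℝ (⊤ : ℕ∞)
      (fun q : ((ℝ × ℝ) × E) × C(unitInterval, E) => superpose B q.2) :=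
    (contDiff_superpose B hB).comp contDiff_snd
  have h2 : ContDiff ℝ (⊤ : ℕ∞)
      (fun q : ((ℝ × ℝ) × E) × C(unitInterval, E) => superpose J q.2) :=
    (contDiff_superpose J hJ).comp contDiff_snd
  unfold flowMap
  fun_prop

/-- The derivative of a smooth map, as a continuous map. -/
def derivMap (B : C(E, E)) (hB : ContDiff ℝ (⊤ : ℕ∞) B) : C(E, E →L[ℝ] E) :=
  ⟨fderiv ℝ B, hB.continuous_fderiv (by simp)⟩

lemma hasFDerivAt_flowMap {B J : C(E, E)} (hB : ContDiff ℝ (⊤ : ℕ∞) B)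
    (hJ : ContDiff ℝ (⊤ : ℕ∞) J) (q v : ((ℝ × ℝ) × E) × C(unitInterval, E)) :
    fderiv ℝ (flowMap B J) q v = (v.1, v.2 - constCLM v.1.2
      - primitive ((q.1.1.1 • pointwiseApply (superpose (derivMap B hB) q.2) v.2
          + v.1.1.1 • superpose B q.2)
        + (q.1.1.2 • pointwiseApply (superpose (derivMap J hJ) q.2) v.2
          + v.1.1.2 • superpose J q.2))) := by
  have hd : ∀ (X : C(E, E)) (hX : ContDiff ℝ (⊤ : ℕ∞) X),
      HasFDerivAt (superpose X) (pointwiseApply (superpose (derivMap X hX) q.2)) q.2 :=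
    fun X hX => hasFDerivAt_superpose X (derivMap X hX)
      (fun x => (hX.differentiable (by simp) x).hasFDerivAt) q.2
  have e1 : HasFDerivAt (fun q : ((ℝ × ℝ) × E) × C(unitInterval, E) => q.1)
      (ContinuousLinearMap.fst ℝ _ _) q := hasFDerivAt_fst
  have e2 : HasFDerivAt (fun q : ((ℝ × ℝ) × E) × C(unitInterval, E) => q.2)
      (ContinuousLinearMap.snd ℝ _ _) q := hasFDerivAt_snd
  have h1 := (e1.fst.fst).smul ((hd B hB).comp q e2)
  have h2 := (e1.fst.snd).smul ((hd J hJ).comp q e2)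
  have h3 := (constCLM (E := E)).hasFDerivAt.comp q e1.snd
  have h4 := (primitive (E := E)).hasFDerivAt.comp q (h1.add h2)
  have hf : HasFDerivAt (flowMap B J) _ q := e1.prodMk ((e2.sub h3).sub h4)
  rw [hf.fderiv]
  rfl

/-- The derivative of `flowMap` at the constant solutions is invertible. -/
def flowEquiv (B J : C(E, E)) (z : E) :
    (((ℝ × ℝ) × E) × C(unitInterval, E)) ≃L[ℝ] (((ℝ × ℝ) × E) × C(unitInterval, E)) :=
  let S : ((ℝ × ℝ) × E) →L[ℝ] C(unitInterval, E) :=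
    constCLM.comp (ContinuousLinearMap.snd ℝ _ _)
    + primitive.comp (((ContinuousLinearMap.fst ℝ ℝ ℝ).comp
        (ContinuousLinearMap.fst ℝ _ _)).smulRight (superpose B (constCLM z))
      + ((ContinuousLinearMap.snd ℝ ℝ ℝ).comp
        (ContinuousLinearMap.fst ℝ _ _)).smulRight (superpose J (constCLM z)))
  ContinuousLinearEquiv.equivOfInverse
    ((ContinuousLinearMap.fst ℝ _ _).prod
      (ContinuousLinearMap.snd ℝ _ _ - S.comp (ContinuousLinearMap.fst ℝ _ _)))
    ((ContinuousLinearMap.fst ℝ _ _).prod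
      (ContinuousLinearMap.snd ℝ _ _ + S.comp (ContinuousLinearMap.fst ℝ _ _)))
    (fun v => by simp) (fun v => by simp)

lemma fderiv_flowMap_const {B J : C(E, E)} (hB : ContDiff ℝ (⊤ : ℕ∞) B)
    (hJ : ContDiff ℝ (⊤ : ℕ∞) J) (z : E) :
    fderiv ℝ (flowMap B J) ((0, z), constCLM z) = (flowEquiv B J z : _ →L[ℝ] _) := by
  refine ContinuousLinearMap.ext fun v => ?_
  rw [hasFDerivAt_flowMap hB hJ]
  refine Prod.ext rfl ?_
  simp only [Prod.fst_zero, Prod.snd_zero, zero_smul, zero_add]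
  exact sub_sub _ _ _

/-- A smooth map on a nonempty interval with prescribed derivative is a primitive. -/
lemma eq_primitive {f : ℝ → E} {g : C(unitInterval, E)} (h0 : f 0 = 0)
    (hf : ∀ t ∈ Icc (0 : ℝ) 1, HasDerivAt f (ext01 g t) t) (t : unitInterval) :
    f t = primitive g t := by
  have hd : ∀ s ∈ Icc (0 : ℝ) 1,
      HasDerivAt (fun s => f s - ∫ r in (0 : ℝ)..s, ext01 g r) 0 s := fun s hs => by
    exact ((hf s hs).sub (hasDerivAt_primitive g s)).congr_deriv (sub_self _)
  have := constant_of_has_deriv_right_zero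
    (fun s hs => (hd s hs).continuousAt.continuousWithinAt)
    (fun s hs => (hd s ⟨hs.1, hs.2.le⟩).hasDerivWithinAt) t t.2
  rw [primitive_apply]
  simpa [h0, sub_eq_zero] using this

/-- The variation of an integral curve `Γ` of `a₁ B + a₂ J` in the direction of
`b₁ B + b₂ J`, when the fields commute along `Γ`. -/
lemma fderiv_flowMap_variation {B J : C(E, E)} (hB : ContDiff ℝ (⊤ : ℕ∞) B)
    (hJ : ContDiff ℝ (⊤ : ℕ∞) J) (a b : ℝ × ℝ) (x : E) (Γ : C(unitInterval, E))
    (hΓ : Γ = constCLM x + primitive (a.1 • superpose B Γ + a.2 • superpose J Γ))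
    (hcomm : ∀ t, fderiv ℝ B (Γ t) (J (Γ t)) = fderiv ℝ J (Γ t) (B (Γ t))) :
    fderiv ℝ (flowMap B J) ((a, x), Γ)
      ((b, 0), ⟨fun t => (t : ℝ) • comb B J b (Γ t), by unfold comb; fun_prop⟩) = ((b, 0), 0) := by
  rw [hasFDerivAt_flowMap hB hJ]
  refine Prod.ext rfl ?_
  simp only [map_zero, sub_zero]
  rw [sub_eq_zero]
  ext t
  set Y := a.1 • superpose B Γ + a.2 • superpose J Γ with hY
  let c : ℝ → E := fun t => x + ∫ s in (0 : ℝ)..t, ext01 Y s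
  have hc : ∀ t, HasDerivAt c (ext01 Y t) t := fun t =>
    (hasDerivAt_primitive Y t).const_add x
  have hcΓ : ∀ t : unitInterval, c t = Γ t := fun t => by
    rw [hΓ]; rfl
  have hX : ∀ (X : C(E, E)), ContDiff ℝ (⊤ : ℕ∞) X → ∀ t,
      HasDerivAt (fun t => X (c t)) (fderiv ℝ X (c t) (ext01 Y t)) t := fun X h t =>
    ((h.differentiable (by simp) _).hasFDerivAt).comp_hasDerivAt t (hc t)
  have := eq_primitive (f := fun t => t • comb B J b (c t)) (by simp) ?_ t
    (g := (a.1 • pointwiseApply (superpose (derivMap B hB) Γ)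
        ⟨fun t => (t : ℝ) • comb B J b (Γ t), by unfold comb; fun_prop⟩ + b.1 • superpose B Γ)
      + (a.2 • pointwiseApply (superpose (derivMap J hJ) Γ)
        ⟨fun t => (t : ℝ) • comb B J b (Γ t), by unfold comb; fun_prop⟩ + b.2 • superpose J Γ))
  · simp only [hcΓ] at this
    exact this
  · intro s hs
    have h1 := (((hX B hB s).const_smul b.1).add ((hX J hJ s).const_smul b.2))
    have h2 := (hasDerivAt_id s).smul h1
    refine h2.congr_deriv ?_
    have e : ∀ g : C(unitInterval, E), ext01 g s = g ⟨s, hs⟩ := fun g => ext01_coe g ⟨s, hs⟩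
    simp only [e, hY, hcΓ ⟨s, hs⟩, ContinuousMap.add_apply, ContinuousMap.smul_apply,
      superpose_apply, pointwiseApply_apply, comb, derivMap, ContinuousMap.coe_mk, map_add,
      map_smul, hcomm, id, Pi.add_apply, Pi.smul_apply, one_smul, smul_add]
    module

theorem exists_local_flow {B J : C(E, E)} (hB : ContDiff ℝ (⊤ : ℕ∞) B)
    (hJ : ContDiff ℝ (⊤ : ℕ∞) J) {V : Set E} (hV : IsOpen V)
    (hcomm : ∀ w ∈ V, fderiv ℝ B w (J w) = fderiv ℝ J w (B w)) {z : E} (hz : z ∈ V) :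
    ∃ Γ : (ℝ × ℝ) × E → C(unitInterval, E), ∀ᶠ u in 𝓝 ((0, z) : (ℝ × ℝ) × E),
      ContDiffAt ℝ (⊤ : ℕ∞) Γ u ∧ (∀ t, Γ u t ∈ V) ∧
      Γ u = constCLM u.2 + primitive (u.1.1 • superpose B (Γ u) + u.1.2 • superpose J (Γ u)) ∧
      ∀ b t, fderiv ℝ Γ u (b, 0) t = (t : ℝ) • comb B J b (Γ u t) := by
  have hF := contDiff_flowMap hB hJ
  have hF' : ∀ q, HasFDerivAt (flowMap B J) (fderiv ℝ (flowMap B J) q) q :=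
    fun q => (hF.differentiable (by simp) q).hasFDerivAt
  have hF0 : HasFDerivAt (flowMap B J) (flowEquiv B J z : _ →L[ℝ] _) ((0, z), constCLM z) := by
    rw [← fderiv_flowMap_const hB hJ]; exact hF' _
  let e := hF.contDiffAt.toOpenPartialHomeomorph (flowMap B J) hF0 (by simp)
  have he : ⇑e = flowMap B J := rfl
  have h0 : ((0, z), constCLM z) ∈ e.source :=
    hF.contDiffAt.mem_toOpenPartialHomeomorph_source hF0 (by simp)
  have hval : flowMap B J ((0, z), constCLM z) = ((0, z), 0) := by
    simp [flowMap]
  have hev : ∀ᶠ q in 𝓝 (((0, z), constCLM z) : ((ℝ × ℝ) × E) × C(unitInterval, E)),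
      q ∈ e.source ∧ (∃ A : (((ℝ × ℝ) × E) × C(unitInterval, E)) ≃L[ℝ]
        (((ℝ × ℝ) × E) × C(unitInterval, E)), fderiv ℝ (flowMap B J) q = (A : _ →L[ℝ] _)) ∧
      ∀ t, q.2 t ∈ V := by
    refine Filter.Eventually.and (e.open_source.mem_nhds h0) (Filter.Eventually.and ?_ ?_)
    · have hc := (hF.continuous_fderiv (by simp)).continuousAt
        (x := (((0, z), constCLM z) : ((ℝ × ℝ) × E) × C(unitInterval, E)))
      have := hc.eventually (p := fun L => L ∈ range ContinuousLinearEquiv.toContinuousLinearMap)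
        (by rw [fderiv_flowMap_const hB hJ]; exact ContinuousLinearEquiv.nhds _)
      filter_upwards [this] with q ⟨A, hA⟩ using ⟨A, hA.symm⟩
    · obtain ⟨r, hr, hrV⟩ := Metric.isOpen_iff.1 hV z hz
      filter_upwards [continuous_snd.continuousAt.preimage_mem_nhds
        (Metric.ball_mem_nhds (constCLM z) hr)] with q hq t
      exact hrV ((ContinuousMap.dist_apply_le_dist t).trans_lt hq)
  have hsymm : Tendsto e.symm (𝓝 ((0, z), 0)) (𝓝 ((0, z), constCLM z)) := by
    have := e.tendsto_symm h0
    rwa [he, hval] at this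
  have htgt : ∀ᶠ q in 𝓝 (((0, z), 0) : ((ℝ × ℝ) × E) × C(unitInterval, E)), q ∈ e.target := by
    have := e.open_target.mem_nhds (e.map_source h0)
    rwa [he, hval] at this
  have hι : Tendsto (fun u : (ℝ × ℝ) × E => (u, (0 : C(unitInterval, E)))) (𝓝 (0, z))
      (𝓝 ((0, z), 0)) := by
    exact (continuous_id.prodMk continuous_const).continuousAt
  refine ⟨fun u => (e.symm (u, 0)).2, ?_⟩
  filter_upwards [hι.eventually ((hsymm.eventually hev).and htgt)] with u ⟨⟨hs, ⟨A, hA⟩, hqV⟩, ht⟩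
  have hq := e.right_inv ht
  set q := e.symm (u, 0) with hqdef
  have hq' : flowMap B J q = (u, 0) := hq
  have hq1 : q.1 = u := congrArg Prod.fst hq'
  have hq2 : q.2 = constCLM u.2
      + primitive (u.1.1 • superpose B q.2 + u.1.2 • superpose J q.2) := by
    have := congrArg Prod.snd hq'
    simp only [flowMap, hq1] at this
    rw [sub_sub, sub_eq_zero] at this
    exact this
  have hAq : HasFDerivAt e (A : _ →L[ℝ] _) (e.symm (u, 0)) := by
    rw [← hqdef, ← hA]; exact hF' q
  have hsm : ContDiffAt ℝ (⊤ : ℕ∞) e.symm (u, 0) :=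
    e.contDiffAt_symm ht hAq hF.contDiffAt
  refine ⟨?_, hqV, hq2, ?_⟩
  · have hpair : ContDiffAt ℝ (⊤ : ℕ∞)
        (fun u : (ℝ × ℝ) × E => (u, (0 : C(unitInterval, E)))) u :=
      contDiffAt_id.prodMk contDiffAt_const
    exact contDiffAt_snd.comp u (ContDiffAt.comp u hsm hpair)
  · intro b t
    have hds : HasFDerivAt e.symm (A.symm : _ →L[ℝ] _) (u, 0) := e.hasFDerivAt_symm ht hAq
    have hpair : HasFDerivAt (fun u : (ℝ × ℝ) × E => (u, (0 : C(unitInterval, E))))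
        ((ContinuousLinearMap.id ℝ _).prod 0) u :=
      (hasFDerivAt_id u).prodMk (hasFDerivAt_const _ u)
    have hcomp := (HasFDerivAt.comp u (f := fun u => (u, (0 : C(unitInterval, E)))) hds hpair).snd
    have hvar := fderiv_flowMap_variation hB hJ u.1 b u.2 q.2 hq2 (fun t => hcomm _ (hqV t))
    have hqe : ((u.1, u.2), q.2) = q := Prod.ext hq1.symm rfl
    rw [hqe, hA] at hvar
    have hvar' := (A.symm_apply_eq.2 hvar.symm)
    have hcomp' : HasFDerivAt (fun u => (e.symm (u, 0)).2) _ u := hcomp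
    rw [hcomp'.fderiv]
    have : (A.symm ((b, 0), 0)).2 t = (t : ℝ) • comb B J b (q.2 t) := by
      rw [hvar']; rfl
    exact this

end LocalFlow

section GlobalFlow

variable {E : Type} [NormedAddCommGroup E] [NormedSpace ℝ E] [CompleteSpace E]

lemma contDiff_comb {B J : C(E, E)} (hB : ContDiff ℝ (⊤ : ℕ∞) B)
    (hJ : ContDiff ℝ (⊤ : ℕ∞) J) (a : ℝ × ℝ) : ContDiff ℝ (⊤ : ℕ∞) (comb B J a) := by
  unfold comb; fun_prop

lemma hasCompactSupport_comb {B J : C(E, E)} (hB : HasCompactSupport B)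
    (hJ : HasCompactSupport J) (a : ℝ × ℝ) : HasCompactSupport (comb B J a) :=
  (hB.smul_left (f := fun _ => a.1)).add (hJ.smul_left (f := fun _ => a.2))

lemma exists_lipschitz_comb {B J : C(E, E)} (hB : ContDiff ℝ (⊤ : ℕ∞) B)
    (hJ : ContDiff ℝ (⊤ : ℕ∞) J) (hBc : HasCompactSupport B) (hJc : HasCompactSupport J)
    (a : ℝ × ℝ) : ∃ K, LipschitzWith K (comb B J a) :=
  (contDiff_comb hB hJ a).lipschitzWith_of_hasCompactSupport (hasCompactSupport_comb hBc hJc a)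
    (by simp)

/-- A bounded Lipschitz vector field has global integral curves. -/
lemma exists_global_integralCurve {X : E → E} {K : NNReal} (hX : LipschitzWith K X) {C : ℝ}
    (hC : ∀ x, ‖X x‖ ≤ C) (w : E) : ∃ γ : ℝ → E, γ 0 = w ∧ ∀ t, HasDerivAt γ (X (γ t)) t := by
  have hC0 : 0 ≤ C := (norm_nonneg _).trans (hC w)
  have key : ∀ T : ℝ, 0 < T → ∃ γ : ℝ → E, γ 0 = w ∧
      ∀ t ∈ Ioo (-T) T, HasDerivAt γ (X (γ t)) t := fun T hT => by
    have hpl : IsPicardLindelof (fun _ : ℝ => X)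
        (⟨0, by constructor <;> linarith⟩ : Icc (-T) T) w (⟨C * T, by positivity⟩) 0
        (⟨C, hC0⟩) K := by
      refine IsPicardLindelof.of_time_independent (fun x _ => hC x) hX.lipschitzOnWith ?_
      simp
      exact le_rfl
    obtain ⟨γ, h0, hγ⟩ := hpl.exists_eq_forall_mem_Icc_hasDerivWithinAt₀
    exact ⟨γ, h0, fun t ht => (hγ t ⟨ht.1.le, ht.2.le⟩).hasDerivAt (Icc_mem_nhds ht.1 ht.2)⟩
  choose! γ h0 hγ using key
  have hun : ∀ T T' : ℝ, 0 < T → T ≤ T' → EqOn (γ T) (γ T') (Ioo (-T) T) := by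
    intro T T' hT hTT'
    refine ODE_solution_unique_of_mem_Ioo (v := fun _ => X) (s := fun _ => univ) (K := K)
      (t₀ := 0) (fun t _ => hX.lipschitzOnWith) ⟨by linarith, hT⟩
      (fun t ht => ⟨hγ T hT t ht, mem_univ _⟩)
      (fun t ht => ⟨hγ T' (hT.trans_le hTT') t ⟨by linarith [ht.1], by linarith [ht.2]⟩,
        mem_univ _⟩) (by rw [h0 T hT, h0 T' (hT.trans_le hTT')])
  refine ⟨fun t => γ (|t| + 1) t, h0 _ (by positivity), fun t => ?_⟩
  have hmem : ∀ s : ℝ, s ∈ Ioo (-(|s| + 1)) (|s| + 1) := fun s => by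
    constructor
    · linarith [neg_abs_le s]
    · linarith [le_abs_self s]
  have hd := hγ (|t| + 2) (by positivity) t
    ⟨by linarith [(hmem t).1], by linarith [(hmem t).2]⟩
  have heq : ∀ s : ℝ, |s| < |t| + 1 → γ (|s| + 1) s = γ (|t| + 2) s := fun s hs =>
    hun _ _ (by positivity) (by linarith) (hmem s)
  have hev : (fun s => γ (|s| + 1) s) =ᶠ[𝓝 t] γ (|t| + 2) := by
    filter_upwards [continuous_abs.continuousAt.eventually_lt (continuousAt_const (y := |t| + 1))
      (by simp)] with s hs using heq s hs
  show HasDerivAt _ (X (γ (|t| + 1) t)) t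
  rw [heq t (by simp)]
  exact hd.congr_of_eventuallyEq hev

/-- `A a w` is the time-one value of the integral curve of `a₁ B + a₂ J` through `w`. -/
structure IsFlow (B J : C(E, E)) (A : ℝ × ℝ → E → E) : Prop where
  zero : ∀ w, A 0 w = w
  hasDerivAt : ∀ a w t, HasDerivAt (fun t : ℝ => A (t • a) w) (comb B J a (A (t • a) w)) t
  lipschitz : ∀ a, ∃ K, LipschitzWith K (comb B J a)

theorem exists_isFlow {B J : C(E, E)} (hB : ContDiff ℝ (⊤ : ℕ∞) B)
    (hJ : ContDiff ℝ (⊤ : ℕ∞) J) (hBc : HasCompactSupport B) (hJc : HasCompactSupport J) :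
    ∃ A, IsFlow B J A := by
  have hlip := exists_lipschitz_comb hB hJ hBc hJc
  have hex : ∀ (a : ℝ × ℝ) (w : E), ∃ γ : ℝ → E, γ 0 = w ∧
      ∀ t, HasDerivAt γ (comb B J a (γ t)) t := fun a w => by
    obtain ⟨K, hK⟩ := hlip a
    obtain ⟨C, hC⟩ := (hasCompactSupport_comb hBc hJc a).exists_bound_of_continuous
      (contDiff_comb hB hJ a).continuous
    exact exists_global_integralCurve hK hC w
  choose γ h0 hγ using hex
  have hsc : ∀ a w t, γ (t • a) w 1 = γ a w t := fun a w t => by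
    obtain ⟨K, hK⟩ := hlip (t • a)
    have : γ (t • a) w = fun s => γ a w (s * t) := by
      refine ODE_solution_unique_univ (v := fun _ => comb B J (t • a)) (s := fun _ => univ)
        (t₀ := 0) (fun _ => hK.lipschitzOnWith) (fun s => ⟨hγ _ _ _, mem_univ _⟩)
        (fun s => ⟨?_, mem_univ _⟩) (by simp [h0])
      have := (hγ a w (s * t)).scomp s ((hasDerivAt_id s).mul_const t)
      refine this.congr_deriv ?_
      simp only [comb, Prod.smul_fst, Prod.smul_snd, smul_eq_mul]
      module
    rw [this]; simp
  refine ⟨fun a w => γ a w 1, fun w => ?_, fun a w t => ?_, hlip⟩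
  · have := hsc 0 w 0
    rw [zero_smul] at this
    simp only [this, h0]
  · simp only [hsc]
    exact hγ a w t

variable {B J : C(E, E)} {A : ℝ × ℝ → E → E}

lemma IsFlow.eq_of_hasDerivAt (hA : IsFlow B J A) {a : ℝ × ℝ} {γ : ℝ → E}
    (hγ : ∀ t ∈ Icc (0 : ℝ) 1, HasDerivAt γ (comb B J a (γ t)) t) : A a (γ 0) = γ 1 := by
  obtain ⟨K, hK⟩ := hA.lipschitz a
  have := ODE_solution_unique (v := fun _ => comb B J a) (K := K)
    (f := fun t => A (t • a) (γ 0)) (g := γ) (a := 0) (b := 1) (fun _ => hK)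
    (fun t _ => (hA.hasDerivAt a _ t).continuousAt.continuousWithinAt)
    (fun t _ => (hA.hasDerivAt a _ t).hasDerivWithinAt)
    (fun t ht => (hγ t ht).continuousAt.continuousWithinAt)
    (fun t ht => (hγ t ⟨ht.1, ht.2.le⟩).hasDerivWithinAt) (by simp [hA.zero])
    (right_mem_Icc.2 zero_le_one)
  simpa using this

lemma IsFlow.add_smul (hA : IsFlow B J A) (a : ℝ × ℝ) (w : E) (s t : ℝ) :
    A ((s + t) • a) w = A (s • a) (A (t • a) w) := by
  have := hA.eq_of_hasDerivAt (a := s • a) (γ := fun r => A ((r * s + t) • a) w) (fun r _ => by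
    have := (hA.hasDerivAt a w (r * s + t)).scomp r (((hasDerivAt_id r).mul_const s).add_const t)
    refine this.congr_deriv ?_
    simp only [comb, Prod.smul_fst, Prod.smul_snd, smul_eq_mul]
    module)
  simpa using this.symm

lemma IsFlow.succ_nsmul (hA : IsFlow B J A) (a : ℝ × ℝ) (w : E) (n : ℕ) :
    A ((n + 1) • a) w = A a (A (n • a) w) := by
  have := hA.add_smul a w 1 n
  rw [one_smul, Nat.cast_smul_eq_nsmul, add_comm, ← Nat.cast_add_one,
    Nat.cast_smul_eq_nsmul] at this
  exact this

theorem IsFlow.eventually_contDiffAt (hA : IsFlow B J A) (hB : ContDiff ℝ (⊤ : ℕ∞) B)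
    (hJ : ContDiff ℝ (⊤ : ℕ∞) J) {V : Set E} (hV : IsOpen V)
    (hcomm : ∀ w ∈ V, fderiv ℝ B w (J w) = fderiv ℝ J w (B w)) {z : E} (hz : z ∈ V) :
    ∀ᶠ u in 𝓝 ((0, z) : (ℝ × ℝ) × E),
      ContDiffAt ℝ (⊤ : ℕ∞) (fun u : (ℝ × ℝ) × E => A u.1 u.2) u ∧ A u.1 u.2 ∈ V ∧
      ∀ b, fderiv ℝ (fun u : (ℝ × ℝ) × E => A u.1 u.2) u (b, 0) = comb B J b (A u.1 u.2) := by
  obtain ⟨Γ, hΓ⟩ := exists_local_flow hB hJ hV hcomm hz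
  have heq : ∀ᶠ u in 𝓝 ((0, z) : (ℝ × ℝ) × E), A u.1 u.2 = Γ u 1 := by
    filter_upwards [hΓ] with u ⟨_, _, hu, _⟩
    set Y := u.1.1 • superpose B (Γ u) + u.1.2 • superpose J (Γ u) with hY
    have hcΓ : ∀ t : unitInterval, u.2 + ∫ s in (0 : ℝ)..t, ext01 Y s = Γ u t := fun t => by
      rw [hu]; rfl
    have := hA.eq_of_hasDerivAt (a := u.1)
      (γ := fun t => u.2 + ∫ s in (0 : ℝ)..t, ext01 Y s) (fun t ht => by
        refine ((hasDerivAt_primitive Y t).const_add u.2).congr_deriv ?_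
        have h1 := ext01_coe Y ⟨t, ht⟩
        have h2 := hcΓ ⟨t, ht⟩
        simp only at h1 h2
        rw [h1, h2]
        rfl)
    have h1 := hcΓ 1
    simp only [intervalIntegral.integral_same, add_zero] at this
    rw [this]
    exact h1
  filter_upwards [hΓ, heq.eventually_nhds] with u ⟨h1, h2, _, h4⟩ heq
  have hev : (fun u : (ℝ × ℝ) × E => A u.1 u.2) =ᶠ[𝓝 u] fun u => Γ u 1 := heq
  let ev : C(unitInterval, E) →L[ℝ] E := ContinuousMap.evalCLM ℝ 1
  have hd : HasFDerivAt (fun u => Γ u 1) (ev.comp (fderiv ℝ Γ u)) u :=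
    ev.hasFDerivAt.comp u (h1.differentiableAt (by simp)).hasFDerivAt
  have hu : A u.1 u.2 = Γ u 1 := hev.self_of_nhds
  refine ⟨?_, hu ▸ h2 1, fun b => ?_⟩
  · exact (ev.contDiff.contDiffAt.comp u h1).congr_of_eventuallyEq hev
  · rw [hev.fderiv_eq, hd.fderiv, hu]
    show fderiv ℝ Γ u (b, 0) 1 = _
    simpa using h4 b 1

/-- The linear map `a ↦ a₁ B(w) + a₂ J(w)`. -/
def combCLM (B J : C(E, E)) (w : E) : ℝ × ℝ →L[ℝ] E :=
  (ContinuousLinearMap.fst ℝ ℝ ℝ).smulRight (B w) + (ContinuousLinearMap.snd ℝ ℝ ℝ).smulRight (J w)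

lemma combCLM_apply (a : ℝ × ℝ) (w : E) : combCLM B J w a = comb B J a w := rfl

/-- What the flow satisfies near a compact invariant set along which the fields commute. -/
structure IsSmoothAction (B J : C(E, E)) (A : ℝ × ℝ → E → E) (K : Set E) : Prop where
  zero : ∀ w, A 0 w = w
  mem : ∀ a, ∀ w ∈ K, A a w ∈ K
  add : ∀ a b, ∀ w ∈ K, A (a + b) w = A a (A b w)
  contDiffAt : ∀ a, ∀ w ∈ K, ContDiffAt ℝ (⊤ : ℕ∞) (fun u : (ℝ × ℝ) × E => A u.1 u.2) (a, w)
  hasFDerivAt : ∀ a, ∀ w ∈ K, HasFDerivAt (fun a => A a w) (combCLM B J (A a w)) a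

theorem IsFlow.isSmoothAction (hA : IsFlow B J A) (hB : ContDiff ℝ (⊤ : ℕ∞) B)
    (hJ : ContDiff ℝ (⊤ : ℕ∞) J) {V : Set E} (hV : IsOpen V)
    (hcomm : ∀ w ∈ V, fderiv ℝ B w (J w) = fderiv ℝ J w (B w)) {K : Set E} (hK : IsCompact K)
    (hKV : K ⊆ V) (hinv : ∀ a, ∀ w ∈ K, A a w ∈ K) : IsSmoothAction B J A K := by
  have hloc : ∀ᶠ a in 𝓝 (0 : ℝ × ℝ), ∀ w ∈ K,
      ContDiffAt ℝ (⊤ : ℕ∞) (fun u : (ℝ × ℝ) × E => A u.1 u.2) (a, w) ∧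
      HasFDerivAt (fun a => A a w) (combCLM B J (A a w)) a := by
    refine hK.eventually_forall_of_forall_eventually (fun w hw => ?_)
    filter_upwards [hA.eventually_contDiffAt hB hJ hV hcomm (hKV hw)] with u ⟨h1, _, h2⟩
    refine ⟨h1, ?_⟩
    have hc := HasFDerivAt.comp u.1 (f := fun a : ℝ × ℝ => (a, u.2))
      (h1.differentiableAt (by simp)).hasFDerivAt
      ((hasFDerivAt_id u.1).prodMk (hasFDerivAt_const u.2 u.1))
    refine hc.congr_fderiv (ContinuousLinearMap.ext fun b => ?_)
    exact h2 b
  obtain ⟨δ, hδ, hloc⟩ := Metric.eventually_nhds_iff.1 hloc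
  simp only [dist_zero_right] at hloc
  have hsmall : ∀ a : ℝ × ℝ, ∃ N : ℕ, 0 < N ∧ ‖(N : ℝ)⁻¹ • a‖ < δ / 2 := fun a => by
    obtain ⟨N, hN⟩ := exists_nat_gt (‖a‖ / (δ / 2))
    have hN0 : (0 : ℝ) < N := lt_of_le_of_lt (by positivity) hN
    refine ⟨N, by exact_mod_cast hN0, ?_⟩
    rw [norm_smul, norm_inv, Real.norm_natCast, inv_mul_lt_iff₀ hN0]
    rwa [div_lt_iff₀ (by positivity)] at hN
  have hN' : ∀ (N : ℕ) (a : ℝ × ℝ), 0 < N → N • ((N : ℝ)⁻¹ • a) = a := fun N a hN => by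
    rw [← Nat.cast_smul_eq_nsmul ℝ, smul_smul, mul_inv_cancel₀ (by positivity), one_smul]
  have hadd0 : ∀ a b : ℝ × ℝ, ‖a‖ < δ / 2 → ‖b‖ < δ / 2 → ∀ w ∈ K,
      A (a + b) w = A a (A b w) := by
    intro a b ha hb w hw
    have := hA.eq_of_hasDerivAt (a := a) (γ := fun t => A (t • a + b) w) (fun t ht => by
      have hn : ‖t • a + b‖ < δ := by
        calc ‖t • a + b‖ ≤ ‖t • a‖ + ‖b‖ := norm_add_le _ _
          _ ≤ 1 * ‖a‖ + ‖b‖ := by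
            rw [norm_smul, Real.norm_of_nonneg ht.1]; gcongr; exact ht.2
          _ < δ := by linarith
      have h1 := (hloc hn w hw).2.comp_hasDerivAt t
        (((hasDerivAt_id t).smul_const a).add_const b)
      refine h1.congr_deriv ?_
      simp [combCLM_apply])
    simpa using this.symm
  have hcd : ∀ (n : ℕ) (a : ℝ × ℝ), ‖a‖ < δ → ∀ w ∈ K,
      ContDiffAt ℝ (⊤ : ℕ∞) (fun u : (ℝ × ℝ) × E => A (n • u.1) u.2) (a, w) := by
    intro n a ha w hw
    induction n with
    | zero =>
      simp only [zero_smul, hA.zero]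
      exact contDiffAt_snd
    | succ n ih =>
      simp only [hA.succ_nsmul]
      have h1 := (hloc ha (A (n • a) w) (hinv _ _ hw)).1
      exact ContDiffAt.comp (a, w) (f := fun u : (ℝ × ℝ) × E => (u.1, A (n • u.1) u.2)) h1
        (contDiffAt_fst.prodMk ih)
  have hadd : ∀ a b, ∀ w ∈ K, A (a + b) w = A a (A b w) := by
    intro a b w hw
    obtain ⟨N, hN0, hN⟩ := hsmall (‖a‖ + ‖b‖, 0)
    have hNr : (0 : ℝ) < N := by exact_mod_cast hN0
    have hle : ‖(N : ℝ)⁻¹ • ((‖a‖ + ‖b‖, 0) : ℝ × ℝ)‖ = (N : ℝ)⁻¹ * (‖a‖ + ‖b‖) := by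
      rw [norm_smul, norm_inv, Real.norm_natCast, Prod.norm_mk, norm_zero,
        max_eq_left (norm_nonneg _), Real.norm_of_nonneg (by positivity)]
    have hna : ‖(N : ℝ)⁻¹ • a‖ < δ / 2 := by
      refine lt_of_le_of_lt ?_ (hle ▸ hN)
      rw [norm_smul, norm_inv, Real.norm_natCast]
      gcongr
      linarith [norm_nonneg b]
    have hnb : ‖(N : ℝ)⁻¹ • b‖ < δ / 2 := by
      refine lt_of_le_of_lt ?_ (hle ▸ hN)
      rw [norm_smul, norm_inv, Real.norm_natCast]
      gcongr
      linarith [norm_nonneg a]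
    let f : ℝ × ℝ → Function.End K := fun a w => ⟨A a w, hinv a w w.2⟩
    have hpow : ∀ (a : ℝ × ℝ) (n : ℕ), f (n • a) = f a ^ n := fun a n => by
      induction n with
      | zero => rw [zero_smul, pow_zero]; funext w; exact Subtype.ext (hA.zero _)
      | succ n ih =>
        rw [_root_.pow_succ', ← ih]
        funext w
        exact Subtype.ext (hA.succ_nsmul a w n)
    have hf : ∀ a b : ℝ × ℝ, ‖a‖ < δ / 2 → ‖b‖ < δ / 2 → f (a + b) = f a * f b :=
      fun a b ha hb => funext fun w => Subtype.ext (hadd0 a b ha hb w w.2)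
    have hcom : Commute (f ((N : ℝ)⁻¹ • a)) (f ((N : ℝ)⁻¹ • b)) := by
      rw [Commute, SemiconjBy, ← hf _ _ hna hnb, ← hf _ _ hnb hna, add_comm]
    have : f (a + b) = f a * f b := by
      rw [← hN' N (a + b) hN0, hpow, smul_add, hf _ _ hna hnb, hcom.mul_pow, ← hpow, ← hpow,
        hN' N a hN0, hN' N b hN0]
    exact congrArg Subtype.val (congrFun this ⟨w, hw⟩)
  refine ⟨hA.zero, hinv, hadd, fun a w hw => ?_, fun a w hw => ?_⟩
  · obtain ⟨N, hN0, hN⟩ := hsmall a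
    have h1 := hcd N ((N : ℝ)⁻¹ • a) (hN.trans (by linarith)) w hw
    have h2 := ContDiffAt.comp (a, w)
      (f := fun u : (ℝ × ℝ) × E => ((N : ℝ)⁻¹ • u.1, u.2)) h1
      ((contDiffAt_fst.const_smul _).prodMk contDiffAt_snd)
    refine h2.congr_of_eventuallyEq (Eventually.of_forall fun u => ?_)
    show A u.1 u.2 = A (N • ((N : ℝ)⁻¹ • u.1)) u.2
    rw [hN' N u.1 hN0]
  · have h1 := (hloc (y := 0) (by simpa using hδ) (A a w) (hinv a w hw)).2
    rw [hA.zero] at h1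
    have hs : HasFDerivAt (fun a' : ℝ × ℝ => a' - a) (ContinuousLinearMap.id ℝ _) a :=
      (hasFDerivAt_id a).sub_const a
    have h2 := HasFDerivAt.comp a (f := fun a' : ℝ × ℝ => a' - a) (by simpa using h1) hs
    refine (h2.congr_of_eventuallyEq (Eventually.of_forall fun a' => ?_)).congr_fderiv
      (ContinuousLinearMap.comp_id _)
    simp only [Function.comp, ← hadd _ _ w hw, sub_add_cancel]

end GlobalFlow

section Fields

lemma eq_sum_e3 (u : R3) : u = u 0 • e3 0 + u 1 • e3 1 + u 2 • e3 2 := by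
  ext i
  fin_cases i <;> simp [e3]

lemma clm_apply_eq (L : R3 →L[ℝ] R3) (u : R3) (i : Fin 3) :
    L u i = u 0 * L (e3 0) i + u 1 * L (e3 1) i + u 2 * L (e3 2) i := by
  conv_lhs => rw [eq_sum_e3 u]
  simp

lemma det_eq (L : R3 →L[ℝ] R3) : LinearMap.det L.toLinearMap =
    L (e3 0) 0 * (cross3 (L (e3 1)) (L (e3 2))) 0 + L (e3 0) 1 * (cross3 (L (e3 1)) (L (e3 2))) 1
      + L (e3 0) 2 * (cross3 (L (e3 1)) (L (e3 2))) 2 := by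
  rw [← LinearMap.det_toMatrix (EuclideanSpace.basisFun (Fin 3) ℝ).toBasis, Matrix.det_fin_three]
  simp only [LinearMap.toMatrix_apply, OrthonormalBasis.coe_toBasis,
    OrthonormalBasis.coe_toBasis_repr_apply, EuclideanSpace.basisFun_apply,
    EuclideanSpace.basisFun_repr, ContinuousLinearMap.coe_coe, cross3, pt, e3]
  simp
  ring

lemma divg_eq (v : R3 → R3) (z : R3) : divg v z =
    fderiv ℝ v z (e3 0) 0 + fderiv ℝ v z (e3 1) 1 + fderiv ℝ v z (e3 2) 2 := by
  rw [divg, LinearMap.trace_eq_matrix_trace ℝ (EuclideanSpace.basisFun (Fin 3) ℝ).toBasis,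
    Matrix.trace_fin_three]
  simp only [LinearMap.toMatrix_apply, OrthonormalBasis.coe_toBasis,
    OrthonormalBasis.coe_toBasis_repr_apply, EuclideanSpace.basisFun_apply,
    EuclideanSpace.basisFun_repr, ContinuousLinearMap.coe_coe, e3]

lemma fderiv_eq_gradient (p : R3 → ℝ) (z u : R3) : fderiv ℝ p z u =
    u 0 * gradient p z 0 + u 1 * gradient p z 1 + u 2 * gradient p z 2 := by
  have h : fderiv ℝ p z u = inner ℝ (gradient p z) u := by
    simp [gradient]
  rw [h, PiLp.inner_apply, Fin.sum_univ_three]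
  simp

lemma fderiv_e3_eq_gradient (p : R3 → ℝ) (z : R3) (i : Fin 3) :
    fderiv ℝ p z (e3 i) = gradient p z i := by
  rw [fderiv_eq_gradient]
  fin_cases i <;> simp [e3]

/-- Divergence-free fields `B`, `J` with `J × B` a gradient commute. -/
lemma fderiv_comm {B J : R3 → R3} {p : R3 → ℝ} {z : R3}
    (hB : DifferentiableAt ℝ B z) (hJ : DifferentiableAt ℝ J z) (hp : ContDiffAt ℝ 2 p z)
    (hdB : divg B z = 0) (hdJ : divg J z = 0)
    (h : ∀ᶠ w in 𝓝 z, cross3 (J w) (B w) = gradient p w) :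
    fderiv ℝ B z (J z) = fderiv ℝ J z (B z) := by
  have hBi : ∀ i, HasFDerivAt (fun w => B w i)
      ((EuclideanSpace.proj i : R3 →L[ℝ] ℝ).comp (fderiv ℝ B z)) z := fun i =>
    (EuclideanSpace.proj i : R3 →L[ℝ] ℝ).hasFDerivAt.comp z hB.hasFDerivAt
  have hJi : ∀ i, HasFDerivAt (fun w => J w i)
      ((EuclideanSpace.proj i : R3 →L[ℝ] ℝ).comp (fderiv ℝ J z)) z := fun i =>
    (EuclideanSpace.proj i : R3 →L[ℝ] ℝ).hasFDerivAt.comp z hJ.hasFDerivAt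
  have hsymm : IsSymmSndFDerivAt ℝ p z := hp.isSymmSndFDerivAt (by simp)
  have hp' : DifferentiableAt ℝ (fderiv ℝ p) z :=
    (hp.fderiv_right (m := 1) (by norm_num)).differentiableAt (by norm_num)
  have hH : ∀ i, HasFDerivAt (fun w => cross3 (J w) (B w) i)
      ((ContinuousLinearMap.apply ℝ ℝ (e3 i)).comp (fderiv ℝ (fderiv ℝ p) z)) z := fun i => by
    have h1 := (ContinuousLinearMap.apply ℝ ℝ (e3 i)).hasFDerivAt.comp z hp'.hasFDerivAt
    refine h1.congr_of_eventuallyEq ?_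
    filter_upwards [h] with w hw
    rw [hw]
    exact (fderiv_e3_eq_gradient p w i).symm
  have h0 := (hH 0).unique (((hJi 1).mul (hBi 2)).sub ((hJi 2).mul (hBi 1)))
  have h1 := (hH 1).unique (((hJi 2).mul (hBi 0)).sub ((hJi 0).mul (hBi 2)))
  have h2 := (hH 2).unique (((hJi 0).mul (hBi 1)).sub ((hJi 1).mul (hBi 0)))
  have s01 := hsymm (e3 0) (e3 1)
  have s02 := hsymm (e3 0) (e3 2)
  have s12 := hsymm (e3 1) (e3 2)
  have a01 := DFunLike.congr_fun h0 (e3 1)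
  have a02 := DFunLike.congr_fun h0 (e3 2)
  have a10 := DFunLike.congr_fun h1 (e3 0)
  have a12 := DFunLike.congr_fun h1 (e3 2)
  have a20 := DFunLike.congr_fun h2 (e3 0)
  have a21 := DFunLike.congr_fun h2 (e3 1)
  rw [divg_eq] at hdB hdJ
  simp at a01 a02 a10 a12 a20 a21
  ext i
  rw [clm_apply_eq, clm_apply_eq (fderiv ℝ J z)]
  fin_cases i
  · simp
    linear_combination J z 0 * hdB - B z 0 * hdJ + a21 - a12 - s12
  · simp
    linear_combination J z 1 * hdB - B z 1 * hdJ + a02 - a20 + s02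
  · simp
    linear_combination J z 2 * hdB - B z 2 * hdJ + a10 - a01 - s01

end Fields

section FluxAction

/-- A smooth action of `ℝ²` near a compact flux surface, generated by `B` and `J` and
preserving the pressure `p`. -/
structure FluxAction (B J : C(R3, R3)) (A : ℝ × ℝ → R3 → R3) (p : R3 → ℝ) (W : Set R3) : Prop
    extends IsSmoothAction B J A W where
  isOpen : IsOpen W
  contDiffAt_p : ∀ w ∈ W, ContDiffAt ℝ (⊤ : ℕ∞) p w
  p_apply : ∀ a, ∀ w ∈ W, p (A a w) = p w
  cross_eq : ∀ w ∈ W, cross3 (J w) (B w) = gradient p w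
  gradient_ne : ∀ w ∈ W, gradient p w ≠ 0

/-- The map `(ψ, θ, ζ) ↦ A (θ β₁(ψ) + ζ β₂(ψ)) (σ ψ)`. -/
def chart (A : ℝ × ℝ → R3 → R3) (σ : ℝ → R3) (β₁ β₂ : ℝ → ℝ × ℝ) (q : R3) : R3 :=
  A (q 1 • β₁ (q 0) + q 2 • β₂ (q 0)) (σ (q 0))

variable {B J : C(R3, R3)} {A : ℝ × ℝ → R3 → R3} {p : R3 → ℝ} {W : Set R3}

section Chart

variable {σ : ℝ → R3} {β₁ β₂ : ℝ → ℝ × ℝ} {q : R3}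

lemma contDiffAt_coord (i : Fin 3) (q : R3) : ContDiffAt ℝ (⊤ : ℕ∞) (fun q : R3 => q i) q :=
  (EuclideanSpace.proj i : R3 →L[ℝ] ℝ).contDiff.contDiffAt

lemma FluxAction.contDiffAt_chart (h : FluxAction B J A p W)
    (hσ : ContDiffAt ℝ (⊤ : ℕ∞) σ (q 0)) (h₁ : ContDiffAt ℝ (⊤ : ℕ∞) β₁ (q 0))
    (h₂ : ContDiffAt ℝ (⊤ : ℕ∞) β₂ (q 0)) (hw : σ (q 0) ∈ W) :
    ContDiffAt ℝ (⊤ : ℕ∞) (chart A σ β₁ β₂) q := by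
  have hc := fun i => contDiffAt_coord i q
  have h1 := h.contDiffAt (q 1 • β₁ (q 0) + q 2 • β₂ (q 0)) _ hw
  have h₁' := h₁.comp q (hc 0)
  have h₂' := h₂.comp q (hc 0)
  exact ContDiffAt.comp q
    (f := fun q : R3 => (q 1 • β₁ (q 0) + q 2 • β₂ (q 0), σ (q 0))) h1
    ((((hc 1).smul h₁').add ((hc 2).smul h₂')).prodMk (hσ.comp q (hc 0)))

lemma FluxAction.fderiv_chart_pt (h : FluxAction B J A p W)
    (hσ : ContDiffAt ℝ (⊤ : ℕ∞) σ (q 0)) (h₁ : ContDiffAt ℝ (⊤ : ℕ∞) β₁ (q 0))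
    (h₂ : ContDiffAt ℝ (⊤ : ℕ∞) β₂ (q 0)) (hw : σ (q 0) ∈ W) (x y : ℝ) :
    fderiv ℝ (chart A σ β₁ β₂) q (pt 0 x y) =
      comb B J (x • β₁ (q 0) + y • β₂ (q 0)) (chart A σ β₁ β₂ q) := by
  have hd := ((h.contDiffAt_chart hσ h₁ h₂ hw).differentiableAt (by simp)).hasFDerivAt
  have hl : HasDerivAt (fun s : ℝ => q + s • pt 0 x y) (pt 0 x y) 0 := by
    simpa using ((hasDerivAt_id (0 : ℝ)).smul_const (pt 0 x y)).const_add q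
  have e1 := HasFDerivAt.comp_hasDerivAt (0 : ℝ) (f := fun s : ℝ => q + s • pt 0 x y)
    (by simpa using hd) hl
  set a := q 1 • β₁ (q 0) + q 2 • β₂ (q 0) with ha
  set b := x • β₁ (q 0) + y • β₂ (q 0) with hb
  have hl2 : HasDerivAt (fun s : ℝ => a + s • b) b 0 := by
    simpa using ((hasDerivAt_id (0 : ℝ)).smul_const b).const_add a
  have e2 := HasFDerivAt.comp_hasDerivAt (0 : ℝ) (f := fun s : ℝ => a + s • b)
    (by simpa using h.hasFDerivAt _ _ hw) hl2
  refine e1.unique (e2.congr_of_eventuallyEq (Eventually.of_forall fun s => ?_))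
  simp only [Function.comp, chart]
  simp [pt, ha, hb]
  congr 1
  module

lemma FluxAction.det_chart (h : FluxAction B J A p W)
    (hσ : ContDiffAt ℝ (⊤ : ℕ∞) σ (q 0)) (h₁ : ContDiffAt ℝ (⊤ : ℕ∞) β₁ (q 0))
    (h₂ : ContDiffAt ℝ (⊤ : ℕ∞) β₂ (q 0)) (hw : σ (q 0) ∈ W) :
    LinearMap.det (fderiv ℝ (chart A σ β₁ β₂) q).toLinearMap =
      -((β₁ (q 0)).1 * (β₂ (q 0)).2 - (β₁ (q 0)).2 * (β₂ (q 0)).1)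
        * deriv (fun t => p (σ t)) (q 0) := by
  set w := chart A σ β₁ β₂ q with hwq
  have hwW : w ∈ W := h.mem _ _ hw
  have hd := ((h.contDiffAt_chart hσ h₁ h₂ hw).differentiableAt (by simp)).hasFDerivAt
  have hl : HasDerivAt (fun s : ℝ => q + s • e3 0) (e3 0) 0 := by
    simpa using ((hasDerivAt_id (0 : ℝ)).smul_const (e3 0)).const_add q
  have e1 := HasFDerivAt.comp_hasDerivAt (0 : ℝ) (f := fun s : ℝ => q + s • e3 0)
    (by simpa using hd) hl
  have e2 := HasFDerivAt.comp_hasDerivAt (0 : ℝ)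
    (by simpa using ((h.contDiffAt_p w hwW).differentiableAt (by simp)).hasFDerivAt) e1
  have hpσ : HasDerivAt (fun t => p (σ t)) (deriv (fun t => p (σ t)) (q 0)) (q 0) := by
    refine DifferentiableAt.hasDerivAt ?_
    exact ((h.contDiffAt_p _ hw).differentiableAt (by simp)).comp (q 0)
      (hσ.differentiableAt (by simp))
  have hpσ' : HasDerivAt (fun t => p (σ t)) (deriv (fun t => p (σ t)) (q 0)) (q 0 + 0) := by
    rwa [add_zero]
  have e3' := HasDerivAt.scomp (0 : ℝ) (h := fun s : ℝ => q 0 + s) hpσ'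
    ((hasDerivAt_id (0 : ℝ)).const_add (q 0))
  have hev : ∀ᶠ s in 𝓝 (0 : ℝ), σ (q 0 + s) ∈ W := by
    have hc : ContinuousAt (fun s : ℝ => σ (q 0 + s)) 0 :=
      ContinuousAt.comp (f := fun s : ℝ => q 0 + s) (by simpa using hσ.continuousAt) (by fun_prop)
    exact hc (h.isOpen.mem_nhds (by simpa using hw))
  have e4 := e2.unique (e3'.congr_of_eventuallyEq (by
    filter_upwards [hev] with s hs
    have : (q + s • e3 0) 0 = q 0 + s := by simp [e3]
    simp only [Function.comp, chart, this]
    exact h.p_apply _ _ hs))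
  rw [fderiv_eq_gradient, ← h.cross_eq w hwW, one_smul] at e4
  have hp1 : e3 1 = pt 0 1 0 := by ext i; fin_cases i <;> simp [e3, pt]
  have hp2 : e3 2 = pt 0 0 1 := by ext i; fin_cases i <;> simp [e3, pt]
  rw [det_eq, hp1, hp2, h.fderiv_chart_pt hσ h₁ h₂ hw, h.fderiv_chart_pt hσ h₁ h₂ hw, ← e4, ← hwq]
  simp [cross3, comb, pt]
  ring

end Chart

end FluxAction

section Transversal

variable {B J : C(R3, R3)} {A : ℝ × ℝ → R3 → R3} {p : R3 → ℝ} {W : Set R3}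

lemma exists_local_inverse {Φ : R3 → R3} {q : R3} (h : ContDiffAt ℝ (⊤ : ℕ∞) Φ q)
    (hd : LinearMap.det (fderiv ℝ Φ q).toLinearMap ≠ 0) :
    ∃ e : OpenPartialHomeomorph R3 R3, q ∈ e.source ∧ ∀ x, e x = Φ x := by
  have hf : HasFDerivAt Φ
      ((fderiv ℝ Φ q).toContinuousLinearEquivOfDetNeZero hd : R3 →L[ℝ] R3) q := by
    simpa using (h.differentiableAt (by simp)).hasFDerivAt
  exact ⟨h.toOpenPartialHomeomorph Φ hf (by simp),
    h.mem_toOpenPartialHomeomorph_source hf (by simp), fun x => rfl⟩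

lemma contDiffAt_symm_of_det_ne_zero (e : OpenPartialHomeomorph R3 R3) {Φ : R3 → R3}
    (he : ∀ x, e x = Φ x) {y : R3} (hy : y ∈ e.target) (h : ContDiffAt ℝ (⊤ : ℕ∞) Φ (e.symm y))
    (hd : LinearMap.det (fderiv ℝ Φ (e.symm y)).toLinearMap ≠ 0) :
    ContDiffAt ℝ (⊤ : ℕ∞) e.symm y := by
  obtain rfl : (e : R3 → R3) = Φ := funext he
  have hf : HasFDerivAt e ((fderiv ℝ e (e.symm y)).toContinuousLinearEquivOfDetNeZero hd :
      R3 →L[ℝ] R3) (e.symm y) := by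
    simpa using (h.differentiableAt (by simp)).hasFDerivAt
  exact e.contDiffAt_symm hy hf h

/-- A curve transversal to the level sets of `p`. -/
structure IsTransversal (p : R3 → ℝ) (W : Set R3) (σ : ℝ → R3) (δ : ℝ) : Prop where
  pos : 0 < δ
  contDiff : ContDiff ℝ (⊤ : ℕ∞) σ
  mem : ∀ t ∈ Ioo (-δ) δ, σ t ∈ W
  deriv_ne : ∀ t ∈ Ioo (-δ) δ, deriv (fun t => p (σ t)) t ≠ 0
  injOn : InjOn (fun t => p (σ t)) (Ioo (-δ) δ)

lemma IsTransversal.zero_mem {σ : ℝ → R3} {δ : ℝ} (h : IsTransversal p W σ δ) :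
    (0 : ℝ) ∈ Ioo (-δ) δ := ⟨by linarith [h.pos], h.pos⟩

lemma IsTransversal.eventually_mem {σ : ℝ → R3} {δ : ℝ} (h : IsTransversal p W σ δ) :
    ∀ᶠ t in 𝓝 (0 : ℝ), t ∈ Ioo (-δ) δ := Ioo_mem_nhds h.zero_mem.1 h.zero_mem.2

lemma injOn_of_deriv_ne_zero {f : ℝ → ℝ} {a b : ℝ}
    (h : ∀ t ∈ Ioo a b, deriv f t ≠ 0) : InjOn f (Ioo a b) := by
  have key : ∀ s ∈ Ioo a b, ∀ t ∈ Ioo a b, s < t → f s ≠ f t := by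
    intro s hs t ht hst heq
    have hsub : Icc s t ⊆ Ioo a b := fun x hx => ⟨hs.1.trans_le hx.1, hx.2.trans_lt ht.2⟩
    obtain ⟨x, hx, hx0⟩ := exists_deriv_eq_zero hst
      (fun x hx => (differentiableAt_of_deriv_ne_zero (h x (hsub hx))).continuousAt
        |>.continuousWithinAt) heq
    exact h x (hsub ⟨hx.1.le, hx.2.le⟩) hx0
  intro s hs t ht heq
  rcases lt_trichotomy s t with hst | hst | hst
  · exact (key s hs t ht hst heq).elim
  · exact hst
  · exact (key t ht s hs hst heq.symm).elim

lemma FluxAction.exists_isTransversal (h : FluxAction B J A p W) {z : R3} (hz : z ∈ W) :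
    ∃ σ δ, σ 0 = z ∧ IsTransversal p W σ δ := by
  set σ : ℝ → R3 := fun t => z + t • gradient p z with hσ
  have hσs : ContDiff ℝ (⊤ : ℕ∞) σ := by fun_prop
  have hσ0 : σ 0 = z := by simp [hσ]
  have hW : ∀ᶠ t in 𝓝 (0 : ℝ), σ t ∈ W :=
    hσs.continuous.continuousAt (h.isOpen.mem_nhds (hσ0.symm ▸ hz))
  have hd : ∀ t, σ t ∈ W →
      HasDerivAt (fun t => p (σ t)) (fderiv ℝ p (σ t) (gradient p z)) t := fun t ht => by
    have h1 : HasDerivAt σ (gradient p z) t := by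
      have := ((hasDerivAt_id t).smul_const (gradient p z)).const_add z
      rwa [one_smul] at this
    exact ((h.contDiffAt_p _ ht).differentiableAt (by simp)).hasFDerivAt.comp_hasDerivAt t h1
  have hne : fderiv ℝ p (σ 0) (gradient p z) ≠ 0 := by
    rw [hσ0, fderiv_eq_gradient]
    intro h0
    refine h.gradient_ne z hz ?_
    have h0' := mul_self_nonneg (gradient p z 0)
    have h1' := mul_self_nonneg (gradient p z 1)
    have h2' := mul_self_nonneg (gradient p z 2)
    have h0'' := mul_self_eq_zero.1 (le_antisymm (by linarith) h0')
    have h1'' := mul_self_eq_zero.1 (le_antisymm (by linarith) h1')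
    have h2'' := mul_self_eq_zero.1 (le_antisymm (by linarith) h2')
    ext i
    fin_cases i
    exacts [h0'', h1'', h2'']
  have hc : ContinuousAt (fun t => fderiv ℝ p (σ t) (gradient p z)) 0 := by
    have h1 : ContinuousAt (fderiv ℝ p) (σ 0) :=
      ((h.contDiffAt_p _ (hσ0.symm ▸ hz)).fderiv_right (m := 1) (by norm_cast)).continuousAt
    exact (h1.comp hσs.continuous.continuousAt).clm_apply continuousAt_const
  obtain ⟨δ, hδ, hδ'⟩ := Metric.eventually_nhds_iff.1 (hW.and (hc.eventually_ne hne))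
  have hdist : ∀ t ∈ Ioo (-δ) δ, dist t 0 < δ := fun t ht => by
    rw [Real.dist_eq, sub_zero]; exact abs_lt.2 ht
  have hder : ∀ t ∈ Ioo (-δ) δ, deriv (fun t => p (σ t)) t ≠ 0 := fun t ht => by
    rw [(hd t (hδ' (hdist t ht)).1).deriv]
    exact (hδ' (hdist t ht)).2
  exact ⟨σ, δ, hσ0, hδ, hσs, fun t ht => (hδ' (hdist t ht)).1, hder, injOn_of_deriv_ne_zero hder⟩

/-- The chart with constant generators. -/
abbrev stdChart (A : ℝ × ℝ → R3 → R3) (σ : ℝ → R3) : R3 → R3 :=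
  chart A σ (fun _ => (1, 0)) (fun _ => (0, 1))

lemma stdChart_apply (σ : ℝ → R3) (q : R3) : stdChart A σ q = A (q 1, q 2) (σ (q 0)) := by
  simp [stdChart, chart]

section

variable {σ : ℝ → R3} {δ : ℝ}

lemma FluxAction.stdChart_regular (h : FluxAction B J A p W) (hσ : IsTransversal p W σ δ)
    {q : R3} (hq : q 0 ∈ Ioo (-δ) δ) : ContDiffAt ℝ (⊤ : ℕ∞) (stdChart A σ) q ∧
      LinearMap.det (fderiv ℝ (stdChart A σ) q).toLinearMap ≠ 0 := by
  refine ⟨h.contDiffAt_chart hσ.contDiff.contDiffAt contDiffAt_const contDiffAt_const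
    (hσ.mem _ hq), ?_⟩
  rw [h.det_chart hσ.contDiff.contDiffAt contDiffAt_const contDiffAt_const (hσ.mem _ hq)]
  simpa using hσ.deriv_ne _ hq

lemma continuousAt_coord (i : Fin 3) (q : R3) : ContinuousAt (fun q : R3 => q i) q :=
  (contDiffAt_coord i q).continuousAt

/-- Points of a level set near `z` are reached from `z` by small elements of `ℝ²`. -/
lemma FluxAction.eventually_mem_orbit (h : FluxAction B J A p W) {z : R3} (hz : z ∈ W) :
    ∀ᶠ y in 𝓝 z, p y = p z → ∃ a : ℝ × ℝ, ‖a‖ ≤ 1 ∧ A a z = y := by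
  obtain ⟨σ, δ, rfl, hσ⟩ := h.exists_isTransversal hz
  obtain ⟨hc, hd⟩ := h.stdChart_regular hσ (q := 0) hσ.zero_mem
  obtain ⟨e, he, heq⟩ := exists_local_inverse hc hd
  have hmap := e.map_nhds_eq he
  have h0 : e 0 = σ 0 := by rw [heq, stdChart_apply]; exact h.zero _
  rw [h0] at hmap
  rw [← hmap, eventually_map]
  have hc0 := (continuousAt_coord 0 (0 : R3)).eventually (hσ.eventually_mem)
  have hn : ContinuousAt (fun q : R3 => ‖((q 1, q 2) : ℝ × ℝ)‖) 0 :=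
    ((continuousAt_coord 1 0).prodMk (continuousAt_coord 2 0)).norm
  filter_upwards [hc0, hn.eventually_lt (continuousAt_const (y := (1 : ℝ))) (by simp)]
    with q hq1 hq2 hp
  rw [heq, stdChart_apply, h.p_apply _ _ (hσ.mem _ hq1)] at hp
  refine ⟨(q 1, q 2), hq2.le, ?_⟩
  rw [heq, stdChart_apply, hσ.injOn hq1 hσ.zero_mem hp]

lemma FluxAction.eventually_eq_zero (h : FluxAction B J A p W) {z : R3} (hz : z ∈ W) :
    ∀ᶠ a in 𝓝 (0 : ℝ × ℝ), A a z = z → a = 0 := by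
  obtain ⟨σ, δ, rfl, hσ⟩ := h.exists_isTransversal hz
  obtain ⟨hc, hd⟩ := h.stdChart_regular hσ (q := 0) hσ.zero_mem
  obtain ⟨e, he, heq⟩ := exists_local_inverse hc hd
  have hcont : Continuous (fun a : ℝ × ℝ => pt 0 a.1 a.2) := by unfold pt; fun_prop
  have hs : ∀ᶠ a in 𝓝 (0 : ℝ × ℝ), pt 0 a.1 a.2 ∈ e.source := by
    refine hcont.continuousAt (e.open_source.mem_nhds ?_)
    convert he
    ext i; fin_cases i <;> simp [pt]
  filter_upwards [hs] with a ha hA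
  have := e.injOn ha he (by
    rw [heq, heq, stdChart_apply, stdChart_apply]
    simp only [PiLp.zero_apply, Prod.mk_zero_zero, h.zero]
    exact hA)
  ext
  · simpa [pt] using congrFun (congrArg WithLp.ofLp this) 1
  · simpa [pt] using congrFun (congrArg WithLp.ofLp this) 2

/-- A period at `σ 0` extends to a smooth family of periods along the transversal `σ`. -/
lemma FluxAction.exists_period (h : FluxAction B J A p W) (hσ : IsTransversal p W σ δ)
    {a : ℝ × ℝ} (ha : A a (σ 0) = σ 0) : ∃ α : ℝ → ℝ × ℝ, α 0 = a ∧
      ∀ᶠ t in 𝓝 0, ContDiffAt ℝ (⊤ : ℕ∞) α t ∧ A (α t) (σ t) = σ t := by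
  have hp0 : (pt 0 a.1 a.2) 0 = 0 := rfl
  obtain ⟨hc, hd⟩ := h.stdChart_regular hσ (q := pt 0 a.1 a.2) hσ.zero_mem
  obtain ⟨e, he, heq⟩ := exists_local_inverse hc hd
  have h0 : e (pt 0 a.1 a.2) = σ 0 := by
    rw [heq, stdChart_apply]; simpa [pt] using ha
  have ht0 : σ 0 ∈ e.target := h0 ▸ e.map_source he
  have hs0 : e.symm (σ 0) = pt 0 a.1 a.2 := by rw [← h0, e.left_inv he]
  refine ⟨fun t => (e.symm (σ t) 1, e.symm (σ t) 2), by simp only [hs0]; rfl, ?_⟩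
  have hσc := hσ.contDiff.continuous.continuousAt (x := (0 : ℝ))
  have hmem : ∀ᶠ t in 𝓝 (0 : ℝ), σ t ∈ e.target := hσc (e.open_target.mem_nhds ht0)
  have hcs : ContinuousAt (fun t => e.symm (σ t) 0) 0 :=
    (continuousAt_coord 0 _).comp ((e.continuousAt_symm ht0).comp hσc)
  have hmem2 : ∀ᶠ t in 𝓝 (0 : ℝ), e.symm (σ t) 0 ∈ Ioo (-δ) δ :=
    hcs (by simp only [hs0]; exact hσ.eventually_mem)
  filter_upwards [hmem, hmem2, hσ.eventually_mem] with t h1 h2 h3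
  obtain ⟨hc, hd⟩ := h.stdChart_regular hσ h2
  have hsm := (contDiffAt_symm_of_det_ne_zero e heq h1 hc hd).comp t hσ.contDiff.contDiffAt
  refine ⟨((contDiffAt_coord 1 _).comp t hsm).prodMk ((contDiffAt_coord 2 _).comp t hsm), ?_⟩
  have hr := e.right_inv h1
  rw [heq, stdChart_apply] at hr
  have hpp := congrArg p hr
  rw [h.p_apply _ _ (hσ.mem _ h2)] at hpp
  have := hσ.injOn h2 h3 hpp
  rwa [this] at hr

end

end Transversal

section Periods

/-- The area spanned by two vectors of the plane. -/
def area (a b : ℝ × ℝ) : ℝ := a.1 * b.2 - a.2 * b.1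

lemma eq_zero_of_area_ne_zero {a b : ℝ × ℝ} (h : area a b ≠ 0) {x y : ℝ}
    (hxy : x • a + y • b = 0) : x = 0 ∧ y = 0 := by
  have h1 := congrArg Prod.fst hxy
  have h2 := congrArg Prod.snd hxy
  simp at h1 h2
  unfold area at h
  constructor
  · refine (mul_eq_zero.1 (?_ : x * (a.1 * b.2 - a.2 * b.1) = 0)).resolve_right h
    linear_combination b.2 * h1 - b.1 * h2
  · refine (mul_eq_zero.1 (?_ : y * (a.1 * b.2 - a.2 * b.1) = 0)).resolve_right h
    linear_combination a.1 * h2 - a.2 * h1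

lemma exists_eq_of_area_ne_zero {a b : ℝ × ℝ} (h : area a b ≠ 0) (v : ℝ × ℝ) :
    ∃ x y : ℝ, v = x • a + y • b := by
  unfold area at h
  refine ⟨(v.1 * b.2 - v.2 * b.1) / (a.1 * b.2 - a.2 * b.1),
    (a.1 * v.2 - a.2 * v.1) / (a.1 * b.2 - a.2 * b.1), ?_⟩
  set D := a.1 * b.2 - a.2 * b.1 with hD
  ext
  · simp only [Prod.fst_add, Prod.smul_fst, smul_eq_mul]
    field_simp
    rw [hD]; ring
  · simp only [Prod.snd_add, Prod.smul_snd, smul_eq_mul]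
    field_simp
    rw [hD]; ring

/-- A discrete cocompact subgroup of the plane is generated by two independent vectors. -/
theorem exists_basis_of_discrete_of_cocompact (L : AddSubgroup (ℝ × ℝ))
    (hd : ∀ᶠ a in 𝓝 (0 : ℝ × ℝ), a ∈ L → a = 0) {R : ℝ}
    (hR : ∀ b : ℝ × ℝ, ∃ l ∈ L, ‖b - l‖ ≤ R) :
    ∃ a₁ a₂ : ℝ × ℝ, area a₁ a₂ ≠ 0 ∧ a₁ ∈ L ∧ a₂ ∈ L ∧
      ∀ l ∈ L, ∃ m n : ℤ, l = (m : ℝ) • a₁ + (n : ℝ) • a₂ := by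
  set M : Submodule ℤ (ℝ × ℝ) := AddSubgroup.toIntSubmodule L with hM
  have hdisc : DiscreteTopology M := by
    obtain ⟨O, hO, hOo, h0⟩ := eventually_nhds_iff.1 hd
    rw [discreteTopology_iff_isOpen_singleton_zero]
    refine isOpen_induced_iff.2 ⟨O, hOo, ?_⟩
    ext ⟨x, hx⟩
    simp only [mem_preimage, mem_singleton_iff, Submodule.mk_eq_zero]
    exact ⟨fun h => hO x h hx, fun h => h ▸ h0⟩
  have hspan : IsZLattice ℝ M := by
    refine ⟨by_contra fun hne => ?_⟩
    obtain ⟨f, hf0, hf⟩ := Submodule.exists_le_ker_of_lt_top _ (lt_top_iff_ne_top.2 hne)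
    obtain ⟨v, hv⟩ : ∃ v, f v ≠ 0 := by
      by_contra! h
      exact hf0 (LinearMap.ext h)
    set g : ℝ × ℝ →L[ℝ] ℝ := LinearMap.toContinuousLinearMap f with hg
    have hbound : ∀ b, ‖f b‖ ≤ ‖g‖ * R := fun b => by
      obtain ⟨l, hl, hbl⟩ := hR b
      have : f l = 0 := hf (Submodule.subset_span hl)
      calc ‖f b‖ = ‖g (b - l)‖ := by simp [hg, this]
        _ ≤ ‖g‖ * ‖b - l‖ := g.le_opNorm _
        _ ≤ ‖g‖ * R := by gcongr
    have := hbound (((‖g‖ * R + 1) / f v) • v)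
    rw [map_smul, smul_eq_mul, div_mul_cancel₀ _ hv] at this
    linarith [Real.le_norm_self (‖g‖ * R + 1)]
  have hfree : Module.Free ℤ M := ZLattice.module_free ℝ M
  have hfin : Module.Finite ℤ M := ZLattice.module_finite ℝ M
  have hrank : Module.finrank ℤ M = 2 := by rw [ZLattice.rank ℝ M]; simp
  set b : Module.Basis (Fin 2) ℤ M := Module.finBasisOfFinrankEq ℤ M hrank with hb
  have hli := (b.ofZLatticeBasis ℝ M).linearIndependent
  have hli' : ∀ x y : ℝ, x • (b 0 : ℝ × ℝ) + y • (b 1 : ℝ × ℝ) = 0 → x = 0 ∧ y = 0 := by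
    intro x y hxy
    have := Fintype.linearIndependent_iff.1 hli ![x, y] (by simpa [Fin.sum_univ_two] using hxy)
    exact ⟨this 0, this 1⟩
  refine ⟨b 0, b 1, fun h => ?_, (b 0).2, (b 1).2, fun l hl => ?_⟩
  · unfold area at h
    have h1 := hli' (b 1 : ℝ × ℝ).2 (-(b 0 : ℝ × ℝ).2) (by
      ext <;> simp
      · linear_combination h
      · ring)
    have h2 := hli' (b 1 : ℝ × ℝ).1 (-(b 0 : ℝ × ℝ).1) (by
      ext <;> simp
      · ring
      · linear_combination -h)
    have h3 := hli' 1 0 (by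
      ext
      · simpa using h2.2
      · simpa using h1.2)
    exact one_ne_zero h3.1
  · refine ⟨b.repr ⟨l, hl⟩ 0, b.repr ⟨l, hl⟩ 1, ?_⟩
    have := congrArg Subtype.val (b.sum_repr ⟨l, hl⟩)
    simp only [Fin.sum_univ_two, Submodule.coe_add, Submodule.coe_smul] at this
    rw [Int.cast_smul_eq_zsmul, Int.cast_smul_eq_zsmul]
    exact this.symm

variable {B J : C(R3, R3)} {A : ℝ × ℝ → R3 → R3} {p : R3 → ℝ} {W : Set R3}

lemma FluxAction.neg_apply (h : FluxAction B J A p W) (a : ℝ × ℝ) {w : R3} (hw : w ∈ W) :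
    A (-a) (A a w) = w := by
  rw [← h.add _ _ _ hw, neg_add_cancel, h.zero]

/-- The periods of the action at a point. -/
def FluxAction.stabilizer (h : FluxAction B J A p W) {w : R3} (hw : w ∈ W) :
    AddSubgroup (ℝ × ℝ) where
  carrier := {a | A a w = w}
  zero_mem' := h.zero w
  add_mem' {a b} ha hb := by
    show A (a + b) w = w
    rw [h.add _ _ _ hw, show A b w = w from hb, show A a w = w from ha]
  neg_mem' {a} ha := by
    have := h.neg_apply a hw
    rwa [show A a w = w from ha] at this

lemma FluxAction.mem_stabilizer (h : FluxAction B J A p W) {w : R3} (hw : w ∈ W) {a : ℝ × ℝ} :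
    a ∈ h.stabilizer hw ↔ A a w = w := Iff.rfl

lemma FluxAction.apply_eq_apply_iff (h : FluxAction B J A p W) {w : R3} (hw : w ∈ W)
    {a b : ℝ × ℝ} : A a w = A b w ↔ a - b ∈ h.stabilizer hw := by
  rw [h.mem_stabilizer]
  constructor
  · intro hab
    rw [sub_eq_neg_add, h.add _ _ _ hw, hab, h.neg_apply b hw]
  · intro hab
    rw [← add_sub_cancel b a, h.add _ _ _ hw, hab]

section Surface

variable {Λ : Set R3} {c : ℝ}

lemma FluxAction.exists_apply_eq (h : FluxAction B J A p W) (hΛ : IsPreconnected Λ)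
    (hW : Λ ⊆ W) (hc : ∀ y ∈ Λ, p y = c) {x y : R3} (hx : x ∈ Λ) (hy : y ∈ Λ) :
    ∃ a, A a x = y := by
  refine hΛ.induction₂' (fun x y => ∃ a, A a x = y) (fun x hx => ?_) ?_ hx hy
  · filter_upwards [nhdsWithin_le_nhds (h.eventually_mem_orbit (hW hx)), self_mem_nhdsWithin]
      with y hy hyΛ
    obtain ⟨a, -, rfl⟩ := hy ((hc y hyΛ).trans (hc x hx).symm)
    exact ⟨⟨a, rfl⟩, -a, h.neg_apply a (hW hx)⟩
  · rintro x y z hx - - ⟨a, rfl⟩ ⟨b, rfl⟩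
    exact ⟨b + a, h.add _ _ _ (hW hx)⟩

lemma FluxAction.exists_bound (h : FluxAction B J A p W) (hΛ : IsPreconnected Λ)
    (hΛc : IsCompact Λ) (hW : Λ ⊆ W) (hc : ∀ y ∈ Λ, p y = c) {x : R3} (hx : x ∈ Λ) :
    ∃ R : ℝ, ∀ y ∈ Λ, ∃ a, ‖a‖ ≤ R ∧ A a x = y := by
  suffices ∃ R : ℝ, ∀ y ∈ Λ, p y = c → ∃ a, ‖a‖ ≤ R ∧ A a x = y by
    obtain ⟨R, hR⟩ := this
    exact ⟨R, fun y hy => hR y hy (hc y hy)⟩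
  refine hΛc.induction_on (p := fun s => ∃ R : ℝ, ∀ y ∈ s, p y = c → ∃ a, ‖a‖ ≤ R ∧ A a x = y)
    ⟨0, by simp⟩ ?_ ?_ ?_
  · rintro s t hst ⟨R, hR⟩
    exact ⟨R, fun y hy => hR y (hst hy)⟩
  · rintro s t ⟨R, hR⟩ ⟨R', hR'⟩
    refine ⟨max R R', ?_⟩
    rintro y (hy | hy) hyc
    · obtain ⟨a, ha, hay⟩ := hR y hy hyc
      exact ⟨a, ha.trans (le_max_left _ _), hay⟩
    · obtain ⟨a, ha, hay⟩ := hR' y hy hyc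
      exact ⟨a, ha.trans (le_max_right _ _), hay⟩
  · intro y hy
    obtain ⟨b, rfl⟩ := h.exists_apply_eq hΛ hW hc hx hy
    refine ⟨_, nhdsWithin_le_nhds (h.eventually_mem_orbit (hW hy)), 1 + ‖b‖, ?_⟩
    intro y' hy' hyc
    obtain ⟨a, ha, rfl⟩ := hy' (hyc.trans (hc _ hy).symm)
    exact ⟨a + b, (norm_add_le _ _).trans (by linarith), h.add _ _ _ (hW hx)⟩

lemma FluxAction.exists_stabilizer_basis (h : FluxAction B J A p W) (hΛ : IsPreconnected Λ)
    (hΛc : IsCompact Λ) (hW : Λ ⊆ W) (hc : ∀ y ∈ Λ, p y = c)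
    (hinv : ∀ a, ∀ y ∈ Λ, A a y ∈ Λ) {x : R3} (hx : x ∈ Λ) :
    ∃ a₁ a₂ : ℝ × ℝ, area a₁ a₂ ≠ 0 ∧ A a₁ x = x ∧ A a₂ x = x ∧
      ∀ a, A a x = x → ∃ m n : ℤ, a = (m : ℝ) • a₁ + (n : ℝ) • a₂ := by
  obtain ⟨R, hR⟩ := h.exists_bound hΛ hΛc hW hc hx
  refine exists_basis_of_discrete_of_cocompact (h.stabilizer (hW hx))
    (h.eventually_eq_zero (hW hx)) (R := R) fun b => ?_
  obtain ⟨a, ha, hab⟩ := hR _ (hinv b x hx)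
  exact ⟨b - a, (h.apply_eq_apply_iff (hW hx)).1 hab.symm, by simpa using ha⟩

end Surface

end Periods

section PeriodFrame

variable {B J : C(R3, R3)} {A : ℝ × ℝ → R3 → R3} {p : R3 → ℝ} {W : Set R3}

lemma eq_zero_of_int_mem_Icc {x : ℝ} (hx : x ∈ Icc (-1 / 2 : ℝ) (1 / 2)) {m : ℤ}
    (h : x = m) : x = 0 := by
  obtain ⟨h1, h2⟩ := hx
  rw [h] at h1 h2
  have h3 : -1 < m := by exact_mod_cast (show (-1 : ℝ) < m by linarith)
  have h4 : m < 1 := by exact_mod_cast (show (m : ℝ) < 1 by linarith)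
  rw [h, show m = 0 by omega, Int.cast_zero]

lemma sub_round_mem_Icc (x : ℝ) : x - round x ∈ Icc (-1 / 2 : ℝ) (1 / 2) := by
  have := abs_le.1 (abs_sub_round x)
  constructor <;> linarith [this.1, this.2]

lemma continuous_pt : Continuous (fun z : ℝ × ℝ × ℝ => pt z.1 z.2.1 z.2.2) := by
  unfold pt; fun_prop

section

variable {σ : ℝ → R3} {δ : ℝ} {α₁ α₂ : ℝ → ℝ × ℝ}

lemma chart_pt (t x y : ℝ) :
    chart A σ α₁ α₂ (pt t x y) = A (x • α₁ t + y • α₂ t) (σ t) := rfl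

lemma FluxAction.eventually_period_eq_zero (h : FluxAction B J A p W)
    (hσ : IsTransversal p W σ δ) (h₁ : ContDiffAt ℝ (⊤ : ℕ∞) α₁ 0)
    (h₂ : ContDiffAt ℝ (⊤ : ℕ∞) α₂ 0) (hne : area (α₁ 0) (α₂ 0) ≠ 0)
    (hper : ∀ a, A a (σ 0) = σ 0 → ∃ m n : ℤ, a = (m : ℝ) • α₁ 0 + (n : ℝ) • α₂ 0) :
    ∀ᶠ t in 𝓝 (0 : ℝ), ∀ x ∈ Icc (-1 / 2 : ℝ) (1 / 2) ×ˢ Icc (-1 / 2 : ℝ) (1 / 2),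
      A (x.1 • α₁ t + x.2 • α₂ t) (σ t) = σ t → x = 0 := by
  have hσ0 := hσ.mem _ hσ.zero_mem
  refine (isCompact_Icc.prod isCompact_Icc).eventually_forall_of_forall_eventually
    (fun x hx => ?_)
  have hcd : ContDiffAt ℝ (⊤ : ℕ∞) (chart A σ α₁ α₂) (pt 0 x.1 x.2) :=
    h.contDiffAt_chart hσ.contDiff.contDiffAt h₁ h₂ hσ0
  have hpt : Tendsto (fun z : ℝ × ℝ × ℝ => pt z.1 z.2.1 z.2.2) (𝓝 (0, x))
      (𝓝 (pt 0 x.1 x.2)) := continuous_pt.tendsto (0, x)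
  by_cases hx0 : x = 0
  · subst hx0
    have hd : LinearMap.det (fderiv ℝ (chart A σ α₁ α₂) (pt 0 0 0)).toLinearMap ≠ 0 := by
      rw [h.det_chart hσ.contDiff.contDiffAt h₁ h₂ hσ0]
      exact mul_ne_zero (neg_ne_zero.2 hne) (hσ.deriv_ne _ hσ.zero_mem)
    obtain ⟨e, he, heq⟩ := exists_local_inverse hcd hd
    have hs := e.open_source.mem_nhds he
    have hpt0 : Tendsto (fun z : ℝ × ℝ × ℝ => pt z.1 0 0) (𝓝 (0, 0)) (𝓝 (pt 0 0 0)) := by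
      have : Continuous (fun z : ℝ × ℝ × ℝ => pt z.1 0 0) := by unfold pt; fun_prop
      exact this.tendsto (0, 0)
    filter_upwards [hpt hs, hpt0 hs] with z hz hz0 hA
    have := e.injOn hz hz0 (by
      rw [heq, heq, chart_pt, chart_pt, hA, zero_smul, zero_smul, add_zero, h.zero])
    ext
    · simpa [pt] using congrFun (congrArg WithLp.ofLp this) 1
    · simpa [pt] using congrFun (congrArg WithLp.ofLp this) 2
  · have hlim1 := hcd.continuousAt.tendsto.comp hpt
    have hlim2 : Tendsto (fun z : ℝ × ℝ × ℝ => σ z.1) (𝓝 (0, x)) (𝓝 (σ 0)) :=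
      (hσ.contDiff.continuous.comp continuous_fst).tendsto (0, x)
    have hneq : chart A σ α₁ α₂ (pt 0 x.1 x.2) ≠ σ 0 := by
      rw [chart_pt]
      intro hA
      obtain ⟨m, n, hmn⟩ := hper _ hA
      obtain ⟨h1, h2⟩ := eq_zero_of_area_ne_zero hne (x := x.1 - m) (y := x.2 - n) (by
        rw [sub_smul, sub_smul, sub_add_sub_comm, hmn, sub_self])
      exact hx0 (Prod.ext (eq_zero_of_int_mem_Icc hx.1 (sub_eq_zero.1 h1))
        (eq_zero_of_int_mem_Icc hx.2 (sub_eq_zero.1 h2)))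
    filter_upwards [(hlim1.sub hlim2).eventually_ne (sub_ne_zero.2 hneq)] with z hz hA
    exact (hz (sub_eq_zero.2 hA)).elim

lemma FluxAction.period_iff (h : FluxAction B J A p W) {w : R3} (hw : w ∈ W) {a b : ℝ × ℝ}
    (ha : A a w = w) (hb : A b w = w)
    (hab : ∀ x ∈ Icc (-1 / 2 : ℝ) (1 / 2) ×ˢ Icc (-1 / 2 : ℝ) (1 / 2),
      A (x.1 • a + x.2 • b) w = w → x = 0) (x y : ℝ) :
    A (x • a + y • b) w = w ↔ (∃ m : ℤ, x = m) ∧ ∃ n : ℤ, y = n := by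
  have hint : ∀ m n : ℤ, (m : ℝ) • a + (n : ℝ) • b ∈ h.stabilizer hw := fun m n => by
    rw [Int.cast_smul_eq_zsmul, Int.cast_smul_eq_zsmul]
    exact add_mem (zsmul_mem ha m) (zsmul_mem hb n)
  constructor
  · intro hA
    have hsub := sub_mem ((h.mem_stabilizer hw).2 hA) (hint (round x) (round y))
    rw [add_sub_add_comm, ← sub_smul, ← sub_smul] at hsub
    have := hab (x - round x, y - round y) ⟨sub_round_mem_Icc x, sub_round_mem_Icc y⟩ hsub
    exact ⟨⟨_, sub_eq_zero.1 (congrArg Prod.fst this)⟩, ⟨_, sub_eq_zero.1 (congrArg Prod.snd this)⟩⟩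
  · rintro ⟨⟨m, rfl⟩, n, rfl⟩
    exact hint m n

/-- Smooth generators, along a transversal, of the lattice of periods scaled by `(2π)⁻¹`. -/
structure IsPeriodFrame (A : ℝ × ℝ → R3 → R3) (σ : ℝ → R3) (ε : ℝ) (β₁ β₂ : ℝ → ℝ × ℝ) :
    Prop where
  contDiffAt₁ : ∀ t ∈ Ioo (-ε) ε, ContDiffAt ℝ (⊤ : ℕ∞) β₁ t
  contDiffAt₂ : ∀ t ∈ Ioo (-ε) ε, ContDiffAt ℝ (⊤ : ℕ∞) β₂ t
  area_ne : ∀ t ∈ Ioo (-ε) ε, area (β₁ t) (β₂ t) ≠ 0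
  eq_zero : ∀ t ∉ Ioo (-ε) ε, β₁ t = 0 ∧ β₂ t = 0
  period_iff : ∀ t ∈ Ioo (-ε) ε, ∀ x y : ℝ, A (x • β₁ t + y • β₂ t) (σ t) = σ t ↔
    (∃ m : ℤ, x = 2 * Real.pi * m) ∧ ∃ n : ℤ, y = 2 * Real.pi * n

lemma FluxAction.exists_isPeriodFrame (h : FluxAction B J A p W) (hσ : IsTransversal p W σ δ)
    {a₁ a₂ : ℝ × ℝ} (hne : area a₁ a₂ ≠ 0) (h₁ : A a₁ (σ 0) = σ 0) (h₂ : A a₂ (σ 0) = σ 0)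
    (hper : ∀ a, A a (σ 0) = σ 0 → ∃ m n : ℤ, a = (m : ℝ) • a₁ + (n : ℝ) • a₂) :
    ∃ ε > 0, ε ≤ δ ∧ ∃ β₁ β₂, IsPeriodFrame A σ ε β₁ β₂ := by
  obtain ⟨α₁, rfl, hα₁⟩ := h.exists_period hσ h₁
  obtain ⟨α₂, rfl, hα₂⟩ := h.exists_period hσ h₂
  have hc₁ := hα₁.self_of_nhds.1
  have hc₂ := hα₂.self_of_nhds.1
  have harea : ∀ᶠ t in 𝓝 (0 : ℝ), area (α₁ t) (α₂ t) ≠ 0 := by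
    have h1 := hc₁.continuousAt
    have h2 := hc₂.continuousAt
    have : ContinuousAt (fun t => area (α₁ t) (α₂ t)) 0 := by
      unfold area; fun_prop
    exact this.eventually_ne hne
  obtain ⟨ε, hε, hall⟩ := Metric.eventually_nhds_iff.1 (hα₁.and (hα₂.and (harea.and
    ((h.eventually_period_eq_zero hσ hc₁ hc₂ hne hper).and hσ.eventually_mem))))
  set ε' := min ε δ with hε'
  have hall' : ∀ t ∈ Ioo (-ε') ε', dist t 0 < ε := fun t ht => by
    rw [Real.dist_eq, sub_zero, abs_lt]
    have := min_le_left ε δ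
    exact ⟨by linarith [ht.1], by linarith [ht.2]⟩
  classical
  have hsm : ∀ α : ℝ → ℝ × ℝ, ∀ t ∈ Ioo (-ε') ε', ContDiffAt ℝ (⊤ : ℕ∞) α t →
      ContDiffAt ℝ (⊤ : ℕ∞)
        (fun t => if t ∈ Ioo (-ε') ε' then (2 * Real.pi)⁻¹ • α t else 0) t := by
    intro α t ht hα
    have hα' : ContDiffAt ℝ (⊤ : ℕ∞) (fun t => (2 * Real.pi)⁻¹ • α t) t := by fun_prop
    refine hα'.congr_of_eventuallyEq ?_
    filter_upwards [Ioo_mem_nhds ht.1 ht.2] with s hs using if_pos hs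
  have hπ := Real.pi_pos
  refine ⟨ε', lt_min hε hσ.pos, min_le_right _ _,
    fun t => if t ∈ Ioo (-ε') ε' then (2 * Real.pi)⁻¹ • α₁ t else 0,
    fun t => if t ∈ Ioo (-ε') ε' then (2 * Real.pi)⁻¹ • α₂ t else 0,
    fun t ht => hsm α₁ t ht (hall (hall' t ht)).1.1,
    fun t ht => hsm α₂ t ht (hall (hall' t ht)).2.1.1, fun t ht => ?_,
    fun t ht => ⟨if_neg ht, if_neg ht⟩, fun t ht x y => ?_⟩
  · rw [if_pos ht, if_pos ht]
    have := (hall (hall' t ht)).2.2.1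
    unfold area at this ⊢
    simp only [Prod.smul_fst, Prod.smul_snd, smul_eq_mul]
    convert mul_ne_zero (inv_ne_zero (by positivity : (2 * Real.pi) ^ 2 ≠ 0)) this using 1
    field_simp
  · rw [if_pos ht, if_pos ht]
    obtain ⟨⟨-, h1⟩, ⟨-, h2⟩, -, h3, h4⟩ := hall (hall' t ht)
    rw [smul_smul, smul_smul, h.period_iff (hσ.mem t h4) h1 h2 h3]
    have : ∀ (x : ℝ) (m : ℤ), x * (2 * Real.pi)⁻¹ = m ↔ x = 2 * Real.pi * m := fun x m => by
      rw [← div_eq_mul_inv, div_eq_iff (by positivity), mul_comm (m : ℝ)]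
    simp only [this]

end

lemma exists_antideriv {f : ℝ → ℝ} {ε : ℝ} (hf : ContDiffOn ℝ (⊤ : ℕ∞) f (Ioo (-ε) ε)) :
    ∃ F : ℝ → ℝ, ContDiffOn ℝ (⊤ : ℕ∞) F (Ioo (-ε) ε) ∧ ∀ t ∈ Ioo (-ε) ε, deriv F t = f t := by
  have hd : ∀ t ∈ Ioo (-ε) ε, HasDerivAt (fun u => ∫ x in (0 : ℝ)..u, f x) (f t) t := by
    intro t ht
    have hsub : uIcc 0 t ⊆ Ioo (-ε) ε :=
      ordConnected_Ioo.uIcc_subset ⟨by linarith [ht.1, ht.2], by linarith [ht.1, ht.2]⟩ ht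
    have hca : ContinuousAt f t := hf.continuousOn.continuousAt (Ioo_mem_nhds ht.1 ht.2)
    refine intervalIntegral.integral_hasDerivAt_right
      (hf.continuousOn.mono hsub).intervalIntegrable ?_ hca
    exact hf.continuousOn.stronglyMeasurableAtFilter isOpen_Ioo t ht
  refine ⟨_, ?_, fun t ht => (hd t ht).deriv⟩
  rw [contDiffOn_infty_iff_deriv_of_isOpen isOpen_Ioo]
  exact ⟨fun t ht => (hd t ht).differentiableAt.differentiableWithinAt,
    hf.congr fun t ht => (hd t ht).deriv⟩

end PeriodFrame

section Existence

open scoped Manifold in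
lemma exists_compactSupport_extension {E F : Type*} [NormedAddCommGroup E] [NormedSpace ℝ E]
    [FiniteDimensional ℝ E] [NormedAddCommGroup F] [NormedSpace ℝ F] {K U : Set E}
    (hK : IsCompact K) (hU : IsOpen U) (hKU : K ⊆ U) {f : E → F}
    (hf : ContDiffOn ℝ (⊤ : ℕ∞) f U) :
    ∃ g : C(E, F), ContDiff ℝ (⊤ : ℕ∞) g ∧ HasCompactSupport g ∧ ∀ᶠ x in 𝓝ˢ K, g x = f x := by
  obtain ⟨L, hL, hKL, hLU⟩ := exists_compact_between hK hU hKU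
  obtain ⟨χ, h1, h0, -⟩ := exists_contMDiffMap_one_nhds_of_subset_interior 𝓘(ℝ, E)
    (n := ⊤) hK.isClosed hKL
  have hχ : ContDiff ℝ (⊤ : ℕ∞) χ := contMDiff_iff_contDiff.1 χ.contMDiff
  have hg : ContDiff ℝ (⊤ : ℕ∞) (fun x => χ x • f x) := by
    refine contDiff_iff_contDiffAt.2 fun x => ?_
    by_cases hx : x ∈ U
    · exact hχ.contDiffAt.smul (hf.contDiffAt (hU.mem_nhds hx))
    · refine contDiffAt_const (c := (0 : F)) |>.congr_of_eventuallyEq ?_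
      filter_upwards [hL.isClosed.isOpen_compl.mem_nhds fun h => hx (hLU h)] with y hy
      rw [h0 y hy, zero_smul]
  refine ⟨⟨_, hg.continuous⟩, hg, HasCompactSupport.intro hL fun x hx => ?_, ?_⟩
  · simp [h0 x hx]
  · filter_upwards [h1] with x hx
    simp [hx]

lemma eventually_mem_connectedComponentIn {p : R3 → ℝ} {U : Set R3} {z : R3} (hU : IsOpen U)
    (hz : z ∈ U) (hp : ContDiffAt ℝ (⊤ : ℕ∞) p z) (hg : gradient p z ≠ 0) :
    ∀ᶠ y in 𝓝 z, p y = p z → y ∈ connectedComponentIn {w | w ∈ U ∧ p w = p z} z := by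
  have hd : HasStrictFDerivAt p (fderiv ℝ p z) z := hp.hasStrictFDerivAt (by simp)
  have hne : fderiv ℝ p z ≠ 0 := fun h => hg (by simp [gradient, h])
  have hr : (fderiv ℝ p z).range = ⊤ := LinearMap.range_eq_top.2
    (LinearMap.surjective (f := (fderiv ℝ p z).toLinearMap)
      fun h => hne (ContinuousLinearMap.coe_injective h))
  set e := hd.implicitToOpenPartialHomeomorph p _ hr with he
  have hfst : ∀ y, (e y).1 = p y := fun y => hd.implicitToOpenPartialHomeomorph_fst hr y
  have hez : e z = (p z, 0) := hd.implicitToOpenPartialHomeomorph_self hr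
  have hzs : z ∈ e.source := hd.mem_implicitToOpenPartialHomeomorph_source hr
  have hzt : (p z, 0) ∈ e.target := hez ▸ e.map_source hzs
  have hsz : e.symm (p z, 0) = z := by rw [← hez, e.left_inv hzs]
  have hnhds : e.target ∩ e.symm ⁻¹' U ∈ 𝓝 (p z, (0 : (fderiv ℝ p z).ker)) :=
    inter_mem (e.open_target.mem_nhds hzt)
      ((e.continuousAt_symm hzt).preimage_mem_nhds (by rw [hsz]; exact hU.mem_nhds hz))
  obtain ⟨r, hr0, hball⟩ := Metric.mem_nhds_iff.1 hnhds
  have hmem : ∀ k ∈ Metric.ball (0 : (fderiv ℝ p z).ker) r,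
      (p z, k) ∈ e.target ∩ e.symm ⁻¹' U := fun k hk => hball (by
    rw [← ball_prod_same]
    exact ⟨Metric.mem_ball_self hr0, hk⟩)
  have hcomp : (fun k => e.symm (p z, k)) '' Metric.ball 0 r ⊆
      connectedComponentIn {w | w ∈ U ∧ p w = p z} z := by
    refine IsPreconnected.subset_connectedComponentIn ?_
      ⟨0, Metric.mem_ball_self hr0, hsz⟩ ?_
    · refine (convex_ball _ _).isPreconnected.image _ ?_
      exact e.continuousOn_symm.comp (by fun_prop) fun k hk => (hmem k hk).1
    · rintro _ ⟨k, hk, rfl⟩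
      refine ⟨(hmem k hk).2, ?_⟩
      rw [← hfst, e.right_inv (hmem k hk).1]
  have hev := (e.continuousAt hzs).tendsto.eventually (Metric.ball_mem_nhds (e z) hr0)
  filter_upwards [hev, e.open_source.mem_nhds hzs] with y hy hys hpy
  have hy2 : e y = (p z, (e y).2) := Prod.ext ((hfst y).trans hpy) rfl
  refine hcomp ⟨(e y).2, ?_, ?_⟩
  · have : dist (e y) (p z, 0) < r := hez ▸ hy
    exact (le_max_right _ _).trans_lt this
  · change e.symm (p z, (e y).2) = y
    rw [← hy2, e.left_inv hys]

variable {B J : C(R3, R3)} {A : ℝ × ℝ → R3 → R3} {p : R3 → ℝ}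

lemma fderiv_apply_comb_eq_zero {w : R3} (h : cross3 (J w) (B w) = gradient p w) (a : ℝ × ℝ) :
    fderiv ℝ p w (comb B J a w) = 0 := by
  rw [fderiv_eq_gradient, ← h]
  simp [cross3, comb, pt]
  ring

/-- The flow preserves `p` and a neighbourhood `V` on whose frontier `p` avoids the value at the
initial point. -/
lemma IsFlow.mem_and_eq (hA : IsFlow B J A) {V K : Set R3} (hV : IsOpen V) (hK : IsClosed K)
    (hVK : V ⊆ K) (hp : ∀ w ∈ K, DifferentiableAt ℝ p w)
    (hcross : ∀ w ∈ V, cross3 (J w) (B w) = gradient p w) {w : R3} (hw : w ∈ V)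
    (hK' : ∀ y ∈ K, p y = p w → y ∈ V) (a : ℝ × ℝ) : A a w ∈ V ∧ p (A a w) = p w := by
  set γ : ℝ → R3 := fun t => A (t • a) w with hγ
  have hγd : ∀ t, HasDerivAt γ (comb B J a (γ t)) t := hA.hasDerivAt a w
  have hγc : Continuous γ := continuous_iff_continuousAt.2 fun t => (hγd t).continuousAt
  set T : Set ℝ := {t | γ t ∈ V ∧ p (γ t) = p w} with hT
  have hopen : IsOpen T := by
    refine isOpen_iff_mem_nhds.2 fun t ht => ?_
    obtain ⟨r, hr, hball⟩ := Metric.mem_nhds_iff.1 (hγc.continuousAt (hV.mem_nhds ht.1))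
    have hd : ∀ s ∈ Metric.ball t r, HasDerivAt (fun s => p (γ s)) 0 s := fun s hs => by
      have := (hp _ (hVK (hball hs))).hasFDerivAt.comp_hasDerivAt s (hγd s)
      rwa [fderiv_apply_comb_eq_zero (hcross _ (hball hs))] at this
    filter_upwards [Metric.ball_mem_nhds t hr] with s hs
    refine ⟨hball hs, ?_⟩
    rw [← ht.2]
    exact Metric.isOpen_ball.is_const_of_deriv_eq_zero (convex_ball t r).isPreconnected
      (fun s hs => (hd s hs).differentiableAt.differentiableWithinAt)
      (fun s hs => (hd s hs).deriv) hs (Metric.mem_ball_self hr)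
  have hclosed : IsClosed T := by
    refine isClosed_of_closure_subset fun t ht => ?_
    have htK : γ t ∈ K := closure_minimal (fun s (hs : s ∈ T) => hVK hs.1)
      (hK.preimage hγc) ht
    have hcont : ContinuousAt (fun s => p (γ s)) t :=
      ContinuousAt.comp (f := γ) (hp _ htK).continuousAt hγc.continuousAt
    have hpt : p (γ t) = p w := by
      have h1 := hcont.continuousWithinAt.mem_closure_image ht
      have h2 : (fun s => p (γ s)) '' T ⊆ {p w} := by
        rintro _ ⟨s, hs, rfl⟩
        exact hs.2
      simpa using closure_minimal h2 isClosed_singleton h1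
    exact ⟨hK' _ htK hpt, hpt⟩
  have h0 : (0 : ℝ) ∈ T := by
    have : γ 0 = w := by simp only [hγ, zero_smul]; exact hA.zero w
    exact ⟨this.symm ▸ hw, by rw [this]⟩
  have h1 : (1 : ℝ) ∈ T := by
    rw [IsClopen.eq_univ ⟨hclosed, hopen⟩ ⟨0, h0⟩]; trivial
  simpa [hT, hγ] using h1

theorem exists_fluxAction {U : Set R3} {B J : R3 → R3} {p : R3 → ℝ} {c : ℝ} {Λ : Set R3} {z₀ : R3}
    (hBJp : IntegrableMagneticField U B J p)
    (hΛ : Λ = connectedComponentIn {z | z ∈ U ∧ p z = c} z₀) (hΛc : IsCompact Λ)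
    (hreg : ∀ z ∈ Λ, gradient p z ≠ 0) :
    ∃ (B' J' : C(R3, R3)) (A : ℝ × ℝ → R3 → R3) (W : Set R3), FluxAction B' J' A p W ∧
      Λ ⊆ W ∧ W ⊆ U ∧ (∀ w ∈ W, B' w = B w) ∧ (∀ w ∈ W, J' w = J w) ∧
      ∀ a, ∀ y ∈ Λ, A a y ∈ Λ := by
  have hUo := hBJp.isOpen_U
  have hpU : ∀ z ∈ U, ContDiffAt ℝ (⊤ : ℕ∞) p z := fun z hz =>
    hBJp.smooth_p.contDiffAt (hUo.mem_nhds hz)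
  have hΛS : ∀ z ∈ Λ, z ∈ U ∧ p z = c := fun z hz =>
    connectedComponentIn_subset {z | z ∈ U ∧ p z = c} z₀ (hΛ ▸ hz)
  have hcomp : ∀ z ∈ Λ, connectedComponentIn {z | z ∈ U ∧ p z = c} z = Λ := fun z hz => by
    rw [hΛ] at hz ⊢
    exact (connectedComponentIn_eq hz).symm
  have hgc : ContinuousOn (gradient p) U := by
    have h1 : ContinuousOn (fderiv ℝ p) U :=
      hBJp.smooth_p.continuousOn_fderiv_of_isOpen hUo (by simp)
    exact (InnerProductSpace.toDual ℝ R3).symm.continuous.comp_continuousOn h1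
  have hO : ∀ᶠ y in 𝓝ˢ Λ, y ∈ U ∧ gradient p y ≠ 0 ∧ (p y = c → y ∈ Λ) := by
    refine mem_nhdsSet_iff_forall.2 fun z hz => ?_
    obtain ⟨hzU, hzc⟩ := hΛS z hz
    have h1 := eventually_mem_connectedComponentIn hUo hzU (hpU z hzU) (hreg z hz)
    rw [hzc, hcomp z hz] at h1
    filter_upwards [hUo.mem_nhds hzU, h1,
      (hgc.continuousAt (hUo.mem_nhds hzU)).eventually_ne (hreg z hz)] with y h1 h2 h3
    exact ⟨h1, h3, h2⟩
  obtain ⟨O, hOo, hΛO, hO⟩ := mem_nhdsSet_iff_exists.1 hO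
  obtain ⟨K, hK, hΛK, hKO⟩ := exists_compact_between hΛc hOo hΛO
  have hKU : K ⊆ U := fun z hz => (hO (hKO hz)).1
  obtain ⟨B', hB', hBc, hBeq⟩ := exists_compactSupport_extension hK hUo hKU hBJp.smooth_B
  obtain ⟨J', hJ', hJc, hJeq⟩ := exists_compactSupport_extension hK hUo hKU hBJp.smooth_J
  obtain ⟨A, hA⟩ := exists_isFlow hB' hJ' hBc hJc
  set V := interior K with hV
  have hVK : V ⊆ K := interior_subset
  have hcross : ∀ w ∈ K, cross3 (J' w) (B' w) = gradient p w := fun w hw => by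
    rw [hBeq.self_of_nhdsSet w hw, hJeq.self_of_nhdsSet w hw, hBJp.hamiltonian w (hKU hw)]
  have hcomm : ∀ w ∈ V, fderiv ℝ B' w (J' w) = fderiv ℝ J' w (B' w) := fun w hw => by
    have hwU := hKU (hVK hw)
    have h1 : (B' : R3 → R3) =ᶠ[𝓝 w] B := eventually_nhdsSet_iff_forall.1 hBeq w (hVK hw)
    have h2 : (J' : R3 → R3) =ᶠ[𝓝 w] J := eventually_nhdsSet_iff_forall.1 hJeq w (hVK hw)
    rw [h1.fderiv_eq, h2.fderiv_eq, h1.self_of_nhds, h2.self_of_nhds]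
    refine fderiv_comm
      ((hBJp.smooth_B.contDiffAt (hUo.mem_nhds hwU)).differentiableAt (by simp))
      ((hBJp.smooth_J.contDiffAt (hUo.mem_nhds hwU)).differentiableAt (by simp))
      ((hpU w hwU).of_le (WithTop.coe_le_coe.2 (le_top (a := (2 : ℕ∞))))) (hBJp.div_B w hwU) (hBJp.div_J w hwU) ?_
    filter_upwards [hUo.mem_nhds hwU] with y hy using hBJp.hamiltonian y hy
  have hpK : ContinuousOn p K := fun z hz => (hpU z (hKU hz)).continuousAt.continuousWithinAt
  obtain ⟨ε, hε, hεK⟩ : ∃ ε > 0, ∀ y ∈ K, |p y - c| ≤ ε → y ∈ V := by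
    have hcpt : IsCompact (K \ V) := hK.diff isOpen_interior
    have hcont : ContinuousOn (fun y => |p y - c|) (K \ V) :=
      ((hpK.mono sdiff_subset).sub continuousOn_const).abs
    rcases (K \ V).eq_empty_or_nonempty with h | h
    · exact ⟨1, one_pos, fun y hy _ => sdiff_eq_empty.1 h hy⟩
    · obtain ⟨y₀, hy₀, hmin⟩ := hcpt.exists_isMinOn h hcont
      have hpos : 0 < |p y₀ - c| := by
        refine abs_pos.2 (sub_ne_zero.2 fun h => hy₀.2 (hΛK ((hO (hKO hy₀.1)).2.2 h)))
      refine ⟨|p y₀ - c| / 2, half_pos hpos, fun y hy hyε => ?_⟩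
      by_contra hyV
      have := isMinOn_iff.1 hmin y ⟨hy, hyV⟩
      linarith
  have hinv : ∀ a, ∀ w ∈ V, |p w - c| ≤ ε → A a w ∈ V ∧ p (A a w) = p w := fun a w hw hwε =>
    hA.mem_and_eq isOpen_interior hK.isClosed hVK
      (fun y hy => (hpU y (hKU hy)).differentiableAt (by simp)) (fun y hy => hcross y (hVK hy)) hw
      (fun y hy hyw => hεK y hy (by rwa [hyw])) a
  have hK₀ : IsCompact (K ∩ (fun y => |p y - c|) ⁻¹' Iic ε) :=
    hK.of_isClosed_subset
      ((hpK.sub continuousOn_const).abs.preimage_isClosed_of_isClosed hK.isClosed isClosed_Iic)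
      inter_subset_left
  have hact := hA.isSmoothAction hB' hJ' isOpen_interior hcomm hK₀
    (fun y hy => hεK y hy.1 hy.2) (fun a w hw => by
      obtain ⟨h1, h2⟩ := hinv a w (hεK w hw.1 hw.2) hw.2
      exact ⟨hVK h1, by simpa [h2] using hw.2⟩)
  set W := V ∩ (fun y => |p y - c|) ⁻¹' Iio ε with hW
  have hWK : W ⊆ K ∩ (fun y => |p y - c|) ⁻¹' Iic ε := 
    inter_subset_inter hVK (preimage_mono Iio_subset_Iic_self)
  have hWinv : ∀ a, ∀ w ∈ W, A a w ∈ W ∧ p (A a w) = p w := fun a w hw => by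
    obtain ⟨h1, h2⟩ := hinv a w hw.1 (le_of_lt hw.2)
    exact ⟨⟨h1, by simpa [h2] using hw.2⟩, h2⟩
  have hΛW : Λ ⊆ W := fun z hz => ⟨hΛK hz, by simpa [(hΛS z hz).2] using hε⟩
  have hWU : W ⊆ U := fun w hw => hKU (hVK hw.1)
  have hflux : FluxAction B' J' A p W :=
    { zero := hact.zero
      mem := fun a w hw => (hWinv a w hw).1
      add := fun a b w hw => hact.add a b w (hWK hw)
      contDiffAt := fun a w hw => hact.contDiffAt a w (hWK hw)
      hasFDerivAt := fun a w hw => hact.hasFDerivAt a w (hWK hw)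
      isOpen := ((hpK.mono hVK).sub continuousOn_const).abs.isOpen_inter_preimage
        isOpen_interior isOpen_Iio
      contDiffAt_p := fun w hw => hpU w (hWU hw)
      p_apply := fun a w hw => (hWinv a w hw).2
      cross_eq := fun w hw => hcross w (hVK hw.1)
      gradient_ne := fun w hw => (hO (hKO (hVK hw.1))).2.1 }
  refine ⟨B', J', A, W, hflux, hΛW, hWU, fun w hw => hBeq.self_of_nhdsSet w (hVK hw.1),
    fun w hw => hJeq.self_of_nhdsSet w (hVK hw.1), fun a y hy => ?_⟩
  have := (hO (hKO (hVK (hWinv a y (hΛW hy)).1.1))).2.2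
  exact this (by rw [(hWinv a y (hΛW hy)).2, (hΛS y hy).2])

end Existence

section HamadaChart

variable {B J : C(R3, R3)} {A : ℝ × ℝ → R3 → R3} {p : R3 → ℝ} {W : Set R3}
  {σ : ℝ → R3} {δ ε : ℝ} {β₁ β₂ : ℝ → ℝ × ℝ}

lemma FluxAction.chart_mem (h : FluxAction B J A p W) {q : R3} (hq : σ (q 0) ∈ W) :
    chart A σ β₁ β₂ q ∈ W := h.mem _ _ hq

lemma FluxAction.p_chart (h : FluxAction B J A p W) {q : R3} (hq : σ (q 0) ∈ W) :
    p (chart A σ β₁ β₂ q) = p (σ (q 0)) := h.p_apply _ _ hq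

lemma FluxAction.chart_eq_chart_iff (h : FluxAction B J A p W)
    (hβ : IsPeriodFrame A σ ε β₁ β₂) (hW : ∀ t ∈ Ioo (-ε) ε, σ t ∈ W)
    (hinj : InjOn (fun t => p (σ t)) (Ioo (-ε) ε)) {q q' : R3} (hq : q ∈ Slab (-ε) ε)
    (hq' : q' ∈ Slab (-ε) ε) : chart A σ β₁ β₂ q = chart A σ β₁ β₂ q' ↔ q 0 = q' 0 ∧
      (∃ m : ℤ, q 1 - q' 1 = 2 * Real.pi * m) ∧ ∃ n : ℤ, q 2 - q' 2 = 2 * Real.pi * n := by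
  have key : q 0 = q' 0 → (chart A σ β₁ β₂ q = chart A σ β₁ β₂ q' ↔
      (∃ m : ℤ, q 1 - q' 1 = 2 * Real.pi * m) ∧ ∃ n : ℤ, q 2 - q' 2 = 2 * Real.pi * n) := by
    intro h0
    rw [← hβ.period_iff (q 0) hq]
    unfold chart
    rw [← h0, h.apply_eq_apply_iff (hW _ hq), h.mem_stabilizer, add_sub_add_comm, ← sub_smul,
      ← sub_smul]
  constructor
  · intro heq
    have h0 : q 0 = q' 0 := hinj hq hq' (by
      have := congrArg p heq
      rwa [h.p_chart (hW _ hq), h.p_chart (hW _ hq')] at this)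
    exact ⟨h0, (key h0).1 heq⟩
  · rintro ⟨h0, h1⟩
    exact (key h0).2 h1

lemma FluxAction.chart_periodic (h : FluxAction B J A p W)
    (hβ : IsPeriodFrame A σ ε β₁ β₂) (hW : ∀ t ∈ Ioo (-ε) ε, σ t ∈ W) (t x y x' y' : ℝ)
    (hx : ∃ m : ℤ, x - x' = 2 * Real.pi * m) (hy : ∃ n : ℤ, y - y' = 2 * Real.pi * n) :
    chart A σ β₁ β₂ (pt t x y) = chart A σ β₁ β₂ (pt t x' y') := by
  rw [chart_pt, chart_pt]
  by_cases ht : t ∈ Ioo (-ε) ε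
  · rw [h.apply_eq_apply_iff (hW _ ht), h.mem_stabilizer, add_sub_add_comm, ← sub_smul,
      ← sub_smul, hβ.period_iff t ht]
    exact ⟨hx, hy⟩
  · simp [(hβ.eq_zero t ht).1, (hβ.eq_zero t ht).2]

lemma isOpen_image_of_det_ne_zero {Φ : R3 → R3} {s : Set R3} (hs : IsOpen s)
    (hΦ : ∀ q ∈ s, ContDiffAt ℝ (⊤ : ℕ∞) Φ q)
    (hd : ∀ q ∈ s, LinearMap.det (fderiv ℝ Φ q).toLinearMap ≠ 0) : IsOpen (Φ '' s) := by
  refine isOpen_iff_mem_nhds.2 ?_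
  rintro _ ⟨q, hq, rfl⟩
  obtain ⟨e, he, heq⟩ := exists_local_inverse (hΦ q hq) (hd q hq)
  obtain rfl : (e : R3 → R3) = Φ := funext heq
  rw [← e.map_nhds_eq he]
  exact image_mem_map (hs.mem_nhds hq)

lemma isOpen_slab (a b : ℝ) : IsOpen (Slab a b) :=
  isOpen_Ioo.preimage (EuclideanSpace.proj 0 : R3 →L[ℝ] ℝ).continuous

end HamadaChart

end Hamada

open Set Filter Topology Hamada in
/-- **Existence of Hamada coordinates near a regular flux surface.** -/
theorem hamada_near_regular_surface
    (U : Set R3) (B J : R3 → R3) (p : R3 → ℝ)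
    (hBJp : IntegrableMagneticField U B J p)
    (c : ℝ) (Λ : Set R3) (z₀ : R3) (hz₀ : z₀ ∈ Λ)
    (hΛ : Λ = connectedComponentIn {z | z ∈ U ∧ p z = c} z₀)
    (hΛc : IsCompact Λ)
    (hreg : ∀ z ∈ Λ, gradient p z ≠ 0) :
    ∃ (ψ₁ ψ₂ : ℝ) (Φ : R3 → R3) (P F G K L : ℝ → ℝ),
      ψ₁ < ψ₂ ∧
      -- Φ is C^∞ on (ψ₁,ψ₂) × ℝ², with values in U
      ContDiffOn ℝ (⊤ : ℕ∞) Φ (Slab ψ₁ ψ₂) ∧ (∀ q ∈ Slab ψ₁ ψ₂, Φ q ∈ U) ∧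
      -- P, F, G, K, L are C^∞ on (ψ₁, ψ₂)
      ContDiffOn ℝ (⊤ : ℕ∞) P (Set.Ioo ψ₁ ψ₂) ∧
      ContDiffOn ℝ (⊤ : ℕ∞) F (Set.Ioo ψ₁ ψ₂) ∧
      ContDiffOn ℝ (⊤ : ℕ∞) G (Set.Ioo ψ₁ ψ₂) ∧
      ContDiffOn ℝ (⊤ : ℕ∞) K (Set.Ioo ψ₁ ψ₂) ∧
      ContDiffOn ℝ (⊤ : ℕ∞) L (Set.Ioo ψ₁ ψ₂) ∧
      -- 2π-periodicity in each of the last two arguments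
      (∀ ψ θ ζ : ℝ, Φ (pt ψ (θ + 2 * Real.pi) ζ) = Φ (pt ψ θ ζ)) ∧
      (∀ ψ θ ζ : ℝ, Φ (pt ψ θ (ζ + 2 * Real.pi)) = Φ (pt ψ θ ζ)) ∧
      -- everywhere invertible differential
      (∀ q ∈ Slab ψ₁ ψ₂, LinearMap.det (fderiv ℝ Φ q).toLinearMap ≠ 0) ∧
      -- image is an open neighborhood of Λ
      IsOpen (Φ '' Slab ψ₁ ψ₂) ∧ Λ ⊆ Φ '' Slab ψ₁ ψ₂ ∧
      -- injectivity modulo 2π in the two angles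
      (∀ q ∈ Slab ψ₁ ψ₂, ∀ q' ∈ Slab ψ₁ ψ₂,
        (Φ q = Φ q' ↔ (q 0 = q' 0 ∧
          (∃ m : ℤ, q 1 - q' 1 = 2 * Real.pi * (m : ℝ)) ∧
          (∃ n : ℤ, q 2 - q' 2 = 2 * Real.pi * (n : ℝ))))) ∧
      -- normal form: p ∘ Φ = P(ψ), and the pulled-back flux fields of B and J are
      -- (0, G′(ψ), F′(ψ)) and (0, L′(ψ), K′(ψ)), expressed as DΦ(w) = det(DΦ) • (X ∘ Φ)
      (∀ q ∈ Slab ψ₁ ψ₂,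
        p (Φ q) = P (q 0) ∧
        (fderiv ℝ Φ q (pt 0 (deriv G (q 0)) (deriv F (q 0)))
          = LinearMap.det (fderiv ℝ Φ q).toLinearMap • B (Φ q)) ∧
        (fderiv ℝ Φ q (pt 0 (deriv L (q 0)) (deriv K (q 0)))
          = LinearMap.det (fderiv ℝ Φ q).toLinearMap • J (Φ q))) := by
  obtain ⟨B', J', A, W, h, hΛW, hWU, hB, hJ, hinv⟩ := exists_fluxAction hBJp hΛ hΛc hreg
  have hconn : IsPreconnected Λ := hΛ ▸ isPreconnected_connectedComponentIn
  have hc : ∀ y ∈ Λ, p y = c := fun y hy =>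
    (connectedComponentIn_subset {z | z ∈ U ∧ p z = c} z₀ (hΛ ▸ hy)).2
  obtain ⟨σ, δ, rfl, hσ⟩ := h.exists_isTransversal (hΛW hz₀)
  obtain ⟨a₁, a₂, harea, ha₁, ha₂, hper⟩ := h.exists_stabilizer_basis hconn hΛc hΛW hc hinv hz₀
  obtain ⟨ε, hε, hεδ, β₁, β₂, hβ⟩ := h.exists_isPeriodFrame hσ harea ha₁ ha₂ hper
  have hsub : Ioo (-ε) ε ⊆ Ioo (-δ) δ := Ioo_subset_Ioo (neg_le_neg hεδ) hεδ
  have hW : ∀ t ∈ Ioo (-ε) ε, σ t ∈ W := fun t ht => hσ.mem t (hsub ht)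
  have hPat : ∀ t ∈ Ioo (-ε) ε, ContDiffAt ℝ (⊤ : ℕ∞) (fun t => p (σ t)) t := fun t ht =>
    (h.contDiffAt_p _ (hW t ht)).comp t hσ.contDiff.contDiffAt
  have hP : ContDiffOn ℝ (⊤ : ℕ∞) (fun t => p (σ t)) (Ioo (-ε) ε) := fun t ht =>
    (hPat t ht).contDiffWithinAt
  have hP' : ContDiffOn ℝ (⊤ : ℕ∞) (deriv fun t => p (σ t)) (Ioo (-ε) ε) :=
    hP.deriv_of_isOpen isOpen_Ioo (by simp)
  have hβ₁ : ContDiffOn ℝ (⊤ : ℕ∞) β₁ (Ioo (-ε) ε) := fun t ht =>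
    (hβ.contDiffAt₁ t ht).contDiffWithinAt
  have hβ₂ : ContDiffOn ℝ (⊤ : ℕ∞) β₂ (Ioo (-ε) ε) := fun t ht =>
    (hβ.contDiffAt₂ t ht).contDiffWithinAt
  obtain ⟨F, hF, hF'⟩ := exists_antideriv (hP'.mul hβ₁.snd)
  obtain ⟨G, hG, hG'⟩ := exists_antideriv (hP'.mul hβ₂.snd).neg
  obtain ⟨K, hK, hK'⟩ := exists_antideriv (hP'.mul hβ₁.fst).neg
  obtain ⟨L, hL, hL'⟩ := exists_antideriv (hP'.mul hβ₂.fst)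
  have hΦ : ∀ q ∈ Slab (-ε) ε, ContDiffAt ℝ (⊤ : ℕ∞) (chart A σ β₁ β₂) q := fun q hq =>
    h.contDiffAt_chart hσ.contDiff.contDiffAt (hβ.contDiffAt₁ _ hq) (hβ.contDiffAt₂ _ hq)
      (hW _ hq)
  have hdet : ∀ q ∈ Slab (-ε) ε, LinearMap.det (fderiv ℝ (chart A σ β₁ β₂) q).toLinearMap =
      -area (β₁ (q 0)) (β₂ (q 0)) * deriv (fun t => p (σ t)) (q 0) := fun q hq =>
    h.det_chart hσ.contDiff.contDiffAt (hβ.contDiffAt₁ _ hq) (hβ.contDiffAt₂ _ hq) (hW _ hq)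
  have hdet0 : ∀ q ∈ Slab (-ε) ε,
      LinearMap.det (fderiv ℝ (chart A σ β₁ β₂) q).toLinearMap ≠ 0 := fun q hq => by
    rw [hdet q hq]
    exact mul_ne_zero (neg_ne_zero.2 (hβ.area_ne _ hq)) (hσ.deriv_ne _ (hsub hq))
  have h2π : ∀ x : ℝ, ∃ m : ℤ, x + 2 * Real.pi - x = 2 * Real.pi * m := fun x => ⟨1, by simp⟩
  have h0π : ∀ x : ℝ, ∃ m : ℤ, x - x = 2 * Real.pi * m := fun x => ⟨0, by simp⟩
  have hfd : ∀ q ∈ Slab (-ε) ε, ∀ x y, fderiv ℝ (chart A σ β₁ β₂) q (pt 0 x y) =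
      comb B' J' (x • β₁ (q 0) + y • β₂ (q 0)) (chart A σ β₁ β₂ q) := fun q hq x y =>
    h.fderiv_chart_pt hσ.contDiff.contDiffAt (hβ.contDiffAt₁ _ hq) (hβ.contDiffAt₂ _ hq)
      (hW _ hq) x y
  refine ⟨-ε, ε, chart A σ β₁ β₂, fun t => p (σ t), F, G, K, L, by linarith,
    fun q hq => (hΦ q hq).contDiffWithinAt, fun q hq => hWU (h.chart_mem (hW _ hq)), hP, hF, hG,
    hK, hL, fun ψ θ ζ => h.chart_periodic hβ hW _ _ _ _ _ (h2π θ) (h0π ζ),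
    fun ψ θ ζ => h.chart_periodic hβ hW _ _ _ _ _ (h0π θ) (h2π ζ), hdet0,
    isOpen_image_of_det_ne_zero (isOpen_slab _ _) hΦ hdet0, fun y hy => ?_,
    fun q hq q' hq' => h.chart_eq_chart_iff hβ hW (hσ.injOn.mono hsub) hq hq',
    fun q hq => ⟨h.p_chart (hW _ hq), ?_, ?_⟩⟩
  · obtain ⟨a, rfl⟩ := h.exists_apply_eq hconn hΛW hc hz₀ hy
    have h0 : (0 : ℝ) ∈ Ioo (-ε) ε := ⟨by linarith, hε⟩
    obtain ⟨x, y, rfl⟩ := exists_eq_of_area_ne_zero (hβ.area_ne 0 h0) a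
    exact ⟨pt 0 x y, h0, chart_pt _ _ _⟩
  · rw [hfd q hq, hdet q hq, hF' _ hq, hG' _ hq, ← hB _ (h.chart_mem (hW _ hq))]
    unfold comb area
    simp only [Prod.fst_add, Prod.snd_add, Prod.smul_fst, Prod.smul_snd, smul_eq_mul]
    module
  · rw [hfd q hq, hdet q hq, hK' _ hq, hL' _ hq, ← hJ _ (h.chart_mem (hW _ hq))]
    unfold comb area
    simp only [Prod.fst_add, Prod.snd_add, Prod.smul_fst, Prod.smul_snd, smul_eq_mul]
    module
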